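/- Let α_0,…,α_5 be complex parameters with α_0+α_1+α_2+α_3+α_4+α_5 = 1. The system A_5(α_0,…,α_5) has a rational solution of Type A if and only if the parameters satisfy one of the following five conditions (indices mod 6): (1) for some i, α_{i+2}, α_{i+3}, α_{i+4}, α_{i+5} ∈ ℤ; (2) for some i, α_{i+1}, α_{i+2}, α_{i+4}, α_{i+5} ∈ ℤ; (3) for some i, α_{i+3}, α_{i+5}, α_i + α_{i+4}, α_i − α_{i+2} ∈ ℤ; (4) for some i, α_{i+3} + α_{i+4}, α_{i+4} + α_{i+5}, α_i + α_{i+1}, α_i − α_{i+4} ∈ ℤ; (5) for some i, α_i + α_{i+1}, α_i + α_{i+5}, α_{i+2} + α_{i+3}, α_{i+3} + α_{i+4}, α_i + α_{i+3} ∈ ℤ. -/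

import Mathlib

open Filter Topology Polynomial

noncomputable section

/-- Evaluation of a complex rational function at a point (junk value where the
reduced denominator vanishes). -/
def evalR (f : RatFunc ℂ) (t : ℂ) : ℂ := RatFunc.eval (RingHom.id ℂ) t f

/-- `f` is defined at `t`: the reduced denominator does not vanish at `t`. -/
def DefinedAt (f : RatFunc ℂ) (t : ℂ) : Prop := Polynomial.eval t (RatFunc.denom f) ≠ 0

/-- `(f 0, …, f 5)` is a rational solution of the `A₅⁽¹⁾` Painlevé system `A₅(α)`:
the two constraints hold identically as rational functions, and the six ODEs hold at
every point where all six components are defined.  (Indices are taken in `Fin 6`,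
i.e. modulo `6`.) -/
def IsA5Solution (α : Fin 6 → ℂ) (f : Fin 6 → RatFunc ℂ) : Prop :=
  f 0 + f 2 + f 4 = RatFunc.X ∧
  f 1 + f 3 + f 5 = RatFunc.X ∧
  ∀ t : ℂ, (∀ j : Fin 6, DefinedAt (f j) t) → ∀ i : Fin 6,
    t / 2 * deriv (evalR (f i)) t =
      evalR (f i) t *
        (evalR (f (i + 1)) t * evalR (f (i + 2)) t
          + evalR (f (i + 1)) t * evalR (f (i + 4)) t
          + evalR (f (i + 3)) t * evalR (f (i + 4)) t
          - evalR (f (i + 2)) t * evalR (f (i + 3)) t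
          - evalR (f (i + 2)) t * evalR (f (i + 5)) t
          - evalR (f (i + 4)) t * evalR (f (i + 5)) t)
      + (1 / 2 - α (i + 2) - α (i + 4)) * evalR (f i) t
      + α i * (evalR (f (i + 2)) t + evalR (f (i + 4)) t)

/-- `f` has a pole at `t = ∞`: `‖f t‖ → ∞` as `‖t‖ → ∞`. -/
def PoleAtInfty (f : RatFunc ℂ) : Prop :=
  Tendsto (fun t => ‖evalR f t‖) (Bornology.cobounded ℂ) atTop

/-- `f` is holomorphic at `t = ∞`: `f` is bounded as `‖t‖ → ∞`. -/
def HoloAtInfty (f : RatFunc ℂ) : Prop :=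
  IsBoundedUnder (· ≤ ·) (Bornology.cobounded ℂ) fun t => ‖evalR f t‖

/-- `f` has a pole at `c ∈ ℂ`: `‖f t‖ → ∞` as `t → c`. -/
def PoleAt (f : RatFunc ℂ) (c : ℂ) : Prop :=
  Tendsto (fun t => ‖evalR f t‖) (𝓝[≠] c) atTop

/-- `f` is regular at `c ∈ ℂ`: it extends continuously to `c`. -/
def RegularAt (f : RatFunc ℂ) (c : ℂ) : Prop :=
  ∃ L : ℂ, Tendsto (fun t => evalR f t) (𝓝[≠] c) (𝓝 L)

/-- `z` is an integer. -/
def IsInt (z : ℂ) : Prop := ∃ n : ℤ, z = (n : ℂ)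

/-- `z` is an even integer. -/
def IsEvenInt (z : ℂ) : Prop := ∃ n : ℤ, z = 2 * (n : ℂ)

/-- A tuple of rational functions has pole configuration of Type A at `t = ∞`. -/
def TypeA (f : Fin 6 → RatFunc ℂ) : Prop :=
  ∃ i : Fin 6,
    (PoleAtInfty (f i) ∧ PoleAtInfty (f (i + 1)) ∧ HoloAtInfty (f (i + 2)) ∧
      HoloAtInfty (f (i + 3)) ∧ HoloAtInfty (f (i + 4)) ∧ HoloAtInfty (f (i + 5))) ∨
    (PoleAtInfty (f i) ∧ PoleAtInfty (f (i + 3)) ∧ HoloAtInfty (f (i + 1)) ∧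
      HoloAtInfty (f (i + 2)) ∧ HoloAtInfty (f (i + 4)) ∧ HoloAtInfty (f (i + 5))) ∨
    (PoleAtInfty (f i) ∧ PoleAtInfty (f (i + 1)) ∧ PoleAtInfty (f (i + 2)) ∧
      PoleAtInfty (f (i + 4)) ∧ HoloAtInfty (f (i + 3)) ∧ HoloAtInfty (f (i + 5)))

/-- A tuple of rational functions has pole configuration of Type B at `t = ∞`. -/
def TypeB (f : Fin 6 → RatFunc ℂ) : Prop :=
  ∃ i : Fin 6,
    PoleAtInfty (f i) ∧ PoleAtInfty (f (i + 1)) ∧ PoleAtInfty (f (i + 2)) ∧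
    PoleAtInfty (f (i + 3)) ∧ HoloAtInfty (f (i + 4)) ∧ HoloAtInfty (f (i + 5))

/-! ### Differentiation of rational functions -/

/-- The formal derivative of a rational function, by the quotient rule. -/
def ratDeriv (f : RatFunc ℂ) : RatFunc ℂ :=
  algebraMap ℂ[X] (RatFunc ℂ)
    (derivative f.num * f.denom - f.num * derivative f.denom) /
    algebraMap ℂ[X] (RatFunc ℂ) (f.denom ^ 2)

theorem ratDeriv_div (p : ℂ[X]) {q : ℂ[X]} (hq : q ≠ 0) :
    ratDeriv (algebraMap ℂ[X] (RatFunc ℂ) p / algebraMap ℂ[X] (RatFunc ℂ) q) =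
      algebraMap ℂ[X] (RatFunc ℂ) (derivative p * q - p * derivative q) /
        algebraMap ℂ[X] (RatFunc ℂ) (q ^ 2) := by
  set f := algebraMap ℂ[X] (RatFunc ℂ) p / algebraMap ℂ[X] (RatFunc ℂ) q with hf
  have h : f.num * q = p * f.denom := (RatFunc.num_mul_eq_mul_denom_iff hq).2 hf
  have h' : derivative f.num * q + f.num * derivative q
      = derivative p * f.denom + p * derivative f.denom := by
    rw [← derivative_mul, ← derivative_mul, h]
  rw [ratDeriv, div_eq_div_iff (RatFunc.algebraMap_ne_zero (pow_ne_zero 2 f.denom_ne_zero))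
    (RatFunc.algebraMap_ne_zero (pow_ne_zero 2 hq)), ← map_mul, ← map_mul]
  refine congrArg (algebraMap ℂ[X] (RatFunc ℂ)) ?_
  clear_value f
  generalize f.denom = d at *
  generalize f.num = n at *
  linear_combination (d * q) * h' - (d * derivative q + derivative d * q) * h

/-- The derivation `d/dX` on rational functions. -/
def dRat : Derivation ℂ (RatFunc ℂ) (RatFunc ℂ) :=
  Derivation.mk'
    { toFun := ratDeriv
      map_add' := fun f g => by
        induction f using RatFunc.induction_on with | _ p q hq =>
        induction g using RatFunc.induction_on with | _ p' q' hq' =>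
        have h1 := RatFunc.algebraMap_ne_zero hq
        have h2 := RatFunc.algebraMap_ne_zero hq'
        rw [div_add_div _ _ h1 h2, ← map_mul, ← map_mul, ← map_add, ← map_mul,
          ratDeriv_div _ (mul_ne_zero hq hq'), ratDeriv_div _ hq, ratDeriv_div _ hq']
        simp only [derivative_mul, map_mul, map_add, map_sub, map_pow]
        field_simp
        ring
      map_smul' := fun a f => by
        induction f using RatFunc.induction_on with | _ p q hq =>
        rw [← RatFunc.div_smul, ratDeriv_div _ hq, ratDeriv_div _ hq, RingHom.id_apply,
          ← RatFunc.div_smul]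
        congr 2
        simp [smul_sub] }
    fun f g => by
      induction f using RatFunc.induction_on with | _ p q hq =>
      induction g using RatFunc.induction_on with | _ p' q' hq' =>
      have h1 := RatFunc.algebraMap_ne_zero hq
      have h2 := RatFunc.algebraMap_ne_zero hq'
      simp only [LinearMap.coe_mk, AddHom.coe_mk, smul_eq_mul]
      rw [div_mul_div_comm, ← map_mul, ← map_mul, 
        ratDeriv_div _ (mul_ne_zero hq hq'), ratDeriv_div _ hq, ratDeriv_div _ hq']
      simp only [derivative_mul, map_mul, map_add, map_sub, map_pow]
      field_simp
      ring

theorem dRat_eq_ratDeriv (f : RatFunc ℂ) : dRat f = ratDeriv f := rfl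

theorem dRat_algebraMap (p : ℂ[X]) :
    dRat (algebraMap ℂ[X] (RatFunc ℂ) p) = algebraMap ℂ[X] (RatFunc ℂ) (derivative p) := by
  have := ratDeriv_div p (one_ne_zero)
  simpa [dRat_eq_ratDeriv] using this

@[simp] theorem dRat_X : dRat RatFunc.X = 1 := by
  rw [← RatFunc.algebraMap_X, dRat_algebraMap]; simp

@[simp] theorem dRat_C (a : ℂ) : dRat (RatFunc.C a) = 0 := by
  rw [← RatFunc.algebraMap_C, dRat_algebraMap]; simp

/-! ### Pointwise evaluation -/

theorem definedAt_iff {f : RatFunc ℂ} {t : ℂ} :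
    DefinedAt f t ↔ ∃ p q : ℂ[X], q.eval t ≠ 0 ∧
      f = algebraMap ℂ[X] (RatFunc ℂ) p / algebraMap ℂ[X] (RatFunc ℂ) q := by
  constructor
  · intro h
    exact ⟨f.num, f.denom, h, (RatFunc.num_div_denom f).symm⟩
  · rintro ⟨p, q, hq, rfl⟩ h
    obtain ⟨r, hr⟩ := RatFunc.denom_div_dvd p q
    apply hq
    rw [hr, eval_mul, h, zero_mul]

theorem evalR_eq (f : RatFunc ℂ) (t : ℂ) : evalR f t = f.num.eval t / f.denom.eval t := by
  simp [evalR, RatFunc.eval, eval₂_id]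

theorem evalR_div (p : ℂ[X]) {q : ℂ[X]} {t : ℂ} (hq : q.eval t ≠ 0) :
    evalR (algebraMap ℂ[X] (RatFunc ℂ) p / algebraMap ℂ[X] (RatFunc ℂ) q) t =
      p.eval t / q.eval t := by
  have hd : DefinedAt _ t := definedAt_iff.2 ⟨p, q, hq, rfl⟩
  have hq0 : q ≠ 0 := by rintro rfl; simp at hq
  have h := congrArg (eval t) ((RatFunc.num_mul_eq_mul_denom_iff hq0
    (x := algebraMap ℂ[X] (RatFunc ℂ) p / algebraMap ℂ[X] (RatFunc ℂ) q)).2 rfl)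
  rw [evalR_eq, div_eq_div_iff hd hq]
  simpa using h

theorem DefinedAt.add {f g : RatFunc ℂ} {t : ℂ} (hf : DefinedAt f t) (hg : DefinedAt g t) :
    DefinedAt (f + g) t := by
  intro h
  obtain ⟨r, hr⟩ := RatFunc.denom_add_dvd f g
  have := congrArg (eval t) hr
  rw [eval_mul, eval_mul, h, zero_mul] at this
  exact mul_ne_zero hf hg this

theorem DefinedAt.mul {f g : RatFunc ℂ} {t : ℂ} (hf : DefinedAt f t) (hg : DefinedAt g t) :
    DefinedAt (f * g) t := by
  intro h
  obtain ⟨r, hr⟩ := RatFunc.denom_mul_dvd f g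
  have := congrArg (eval t) hr
  rw [eval_mul, eval_mul, h, zero_mul] at this
  exact mul_ne_zero hf hg this

theorem definedAt_C (a t : ℂ) : DefinedAt (RatFunc.C a) t := by simp [DefinedAt]

theorem evalR_add {f g : RatFunc ℂ} {t : ℂ} (hf : DefinedAt f t) (hg : DefinedAt g t) :
    evalR (f + g) t = evalR f t + evalR g t :=
  RatFunc.eval_add _ _ (by simpa [eval₂_id, DefinedAt] using hf)
    (by simpa [eval₂_id, DefinedAt] using hg)

theorem evalR_mul {f g : RatFunc ℂ} {t : ℂ} (hf : DefinedAt f t) (hg : DefinedAt g t) :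
    evalR (f * g) t = evalR f t * evalR g t :=
  RatFunc.eval_mul _ _ (by simpa [eval₂_id, DefinedAt] using hf)
    (by simpa [eval₂_id, DefinedAt] using hg)

theorem evalR_C (a t : ℂ) : evalR (RatFunc.C a) t = a := by simp [evalR]

theorem DefinedAt.neg {f : RatFunc ℂ} {t : ℂ} (hf : DefinedAt f t) : DefinedAt (-f) t := by
  have : -f = RatFunc.C (-1) * f := by simp
  rw [this]; exact (definedAt_C _ _).mul hf

theorem evalR_neg {f : RatFunc ℂ} {t : ℂ} (hf : DefinedAt f t) :
    evalR (-f) t = - evalR f t := by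
  have : -f = RatFunc.C (-1) * f := by simp
  rw [this, evalR_mul (definedAt_C _ _) hf, evalR_C]; ring

theorem DefinedAt.sub {f g : RatFunc ℂ} {t : ℂ} (hf : DefinedAt f t) (hg : DefinedAt g t) :
    DefinedAt (f - g) t := by
  rw [sub_eq_add_neg]; exact hf.add hg.neg

theorem evalR_sub {f g : RatFunc ℂ} {t : ℂ} (hf : DefinedAt f t) (hg : DefinedAt g t) :
    evalR (f - g) t = evalR f t - evalR g t := by
  rw [sub_eq_add_neg, evalR_add hf hg.neg, evalR_neg hg, sub_eq_add_neg]

theorem DefinedAt.dRat {f : RatFunc ℂ} {t : ℂ} (hf : DefinedAt f t) : DefinedAt (dRat f) t :=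
  definedAt_iff.2 ⟨_, _, by simpa [DefinedAt] using hf, rfl⟩

theorem deriv_evalR {f : RatFunc ℂ} {t : ℂ} (hf : DefinedAt f t) :
    deriv (evalR f) t = evalR (dRat f) t := by
  have h1 : evalR f = fun t => f.num.eval t / f.denom.eval t := funext (evalR_eq f)
  rw [h1, dRat_eq_ratDeriv, ratDeriv, evalR_div _ (by simpa [DefinedAt] using hf)]
  rw [((f.num.hasDerivAt t).fun_div (f.denom.hasDerivAt t) hf).deriv]
  simp

theorem eventually_definedAt (f : RatFunc ℂ) : ∀ᶠ t in cofinite, DefinedAt f t := by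
  have h : {t | f.denom.eval t = 0}.Finite := by
    refine (f.denom.roots.toFinset.finite_toSet).subset fun t ht => ?_
    simpa [f.denom_ne_zero] using ht
  simpa [DefinedAt, Filter.eventually_cofinite] using h

theorem eq_of_evalR_eventuallyEq {f g : RatFunc ℂ}
    (h : ∀ᶠ t in cofinite, evalR f t = evalR g t) : f = g := by
  have h0 : ∀ᶠ t in cofinite, evalR (f - g) t = 0 := by
    filter_upwards [h, eventually_definedAt f, eventually_definedAt g] with t ht hf hg
    rw [evalR_sub hf hg, ht, sub_self]
  have h1 : ∀ᶠ t in cofinite, (f - g).num.eval t = 0 := by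
    filter_upwards [h0, eventually_definedAt (f - g)] with t ht hd
    rw [evalR_eq, div_eq_zero_iff] at ht
    exact ht.resolve_right hd
  have h2 : (f - g).num = 0 := by
    refine Polynomial.eq_zero_of_infinite_isRoot _ ?_
    refine Set.Infinite.mono (fun t ht => ht) (?_ : {t | (f - g).num.eval t = 0}.Infinite)
    intro hfin
    rw [Filter.eventually_cofinite] at h1
    exact Set.infinite_univ ((hfin.union h1).subset fun t _ => by
      by_cases hh : (f - g).num.eval t = 0
      · exact Or.inl hh
      · exact Or.inr hh)
  exact sub_eq_zero.1 (RatFunc.num_eq_zero_iff.1 h2)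

/-! ### Leading terms at a finite point -/

/-- `f = m (X - c) ^ n + ⋯` up to terms of higher order at `c`; here `m` may vanish. -/
def HasLead (c : ℂ) (n : ℤ) (m : ℂ) (f : RatFunc ℂ) : Prop :=
  ∃ p q : ℂ[X], q.eval c ≠ 0 ∧ p.eval c = m * q.eval c ∧
    f = (RatFunc.X - RatFunc.C c) ^ n *
      (algebraMap ℂ[X] (RatFunc ℂ) p / algebraMap ℂ[X] (RatFunc ℂ) q)

theorem algebraMap_X_sub_C (c : ℂ) :
    algebraMap ℂ[X] (RatFunc ℂ) (X - C c) = RatFunc.X - RatFunc.C c := by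
  rw [map_sub, RatFunc.algebraMap_X, RatFunc.algebraMap_C]

theorem X_sub_C_ne_zero_ratFunc (c : ℂ) : (RatFunc.X - RatFunc.C c : RatFunc ℂ) ≠ 0 := by
  rw [← algebraMap_X_sub_C]
  exact RatFunc.algebraMap_ne_zero (Polynomial.X_sub_C_ne_zero c)

theorem algebraMap_ne_zero_of_eval_ne_zero {c : ℂ} {q : ℂ[X]} (hq : q.eval c ≠ 0) :
    algebraMap ℂ[X] (RatFunc ℂ) q ≠ 0 :=
  RatFunc.algebraMap_ne_zero (by rintro rfl; simp at hq)

namespace HasLead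

variable {c : ℂ} {n k : ℤ} {m e : ℂ} {f g : RatFunc ℂ}

theorem add (hf : HasLead c n m f) (hg : HasLead c n e g) : HasLead c n (m + e) (f + g) := by
  obtain ⟨p, q, hq, hp, rfl⟩ := hf
  obtain ⟨p', q', hq', hp', rfl⟩ := hg
  refine ⟨p * q' + p' * q, q * q', by simp [hq, hq'], by simp [hp, hp']; ring, ?_⟩
  have h1 := algebraMap_ne_zero_of_eval_ne_zero hq
  have h2 := algebraMap_ne_zero_of_eval_ne_zero hq'
  simp only [map_add, map_mul]
  field_simp

theorem mul (hf : HasLead c n m f) (hg : HasLead c k e g) :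
    HasLead c (n + k) (m * e) (f * g) := by
  obtain ⟨p, q, hq, hp, rfl⟩ := hf
  obtain ⟨p', q', hq', hp', rfl⟩ := hg
  refine ⟨p * p', q * q', by simp [hq, hq'], by simp [hp, hp']; ring, ?_⟩
  rw [zpow_add₀ (X_sub_C_ne_zero_ratFunc c)]
  simp only [map_mul]
  ring

theorem algebraMap_polynomial (c : ℂ) (p : ℂ[X]) :
    HasLead c 0 (p.eval c) (algebraMap ℂ[X] (RatFunc ℂ) p) :=
  ⟨p, 1, by simp, by simp, by simp⟩

theorem const (c a : ℂ) : HasLead c 0 a (RatFunc.C a) := by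
  simpa using algebraMap_polynomial c (C a)

theorem ratX (c : ℂ) : HasLead c 0 c RatFunc.X := by
  simpa using algebraMap_polynomial c X

theorem zpow_X_sub_C (c : ℂ) (n : ℤ) : HasLead c n 1 ((RatFunc.X - RatFunc.C c) ^ n) :=
  ⟨1, 1, by simp, by simp, by simp⟩

theorem zero (c : ℂ) (n : ℤ) : HasLead c n 0 0 := ⟨0, 1, by simp, by simp, by simp⟩

theorem C_mul (a : ℂ) (hf : HasLead c n m f) : HasLead c n (a * m) (RatFunc.C a * f) := by
  simpa using (const c a).mul hf

theorem neg (hf : HasLead c n m f) : HasLead c n (-m) (-f) := by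
  simpa using hf.C_mul (-1)

theorem sub (hf : HasLead c n m f) (hg : HasLead c n e g) : HasLead c n (m - e) (f - g) := by
  simpa [sub_eq_add_neg] using hf.add hg.neg

theorem sum {ι : Type*} {s : Finset ι} {m : ι → ℂ} {f : ι → RatFunc ℂ}
    (h : ∀ i ∈ s, HasLead c n (m i) (f i)) : HasLead c n (∑ i ∈ s, m i) (∑ i ∈ s, f i) := by
  classical
  induction s using Finset.induction_on with
  | empty => simpa using zero c n
  | insert a s ha ih =>
    rw [Finset.sum_insert ha, Finset.sum_insert ha]
    exact (h a (by simp)).add (ih fun i hi => h i (by simp [hi]))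

theorem inv (hf : HasLead c n m f) (hm : m ≠ 0) : HasLead c (-n) m⁻¹ f⁻¹ := by
  obtain ⟨p, q, hq, hp, rfl⟩ := hf
  refine ⟨q, p, by rw [hp]; exact mul_ne_zero hm hq, by rw [hp]; field_simp, ?_⟩
  rw [mul_inv, inv_div, zpow_neg]

theorem dRat (hf : HasLead c n m f) : HasLead c (n - 1) (n * m) (dRat f) := by
  obtain ⟨p, q, hq, hp, rfl⟩ := hf
  have hq0 : q ≠ 0 := by rintro rfl; simp at hq
  have h1 := algebraMap_ne_zero_of_eval_ne_zero hq
  have hX := X_sub_C_ne_zero_ratFunc c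
  refine ⟨C (n : ℂ) * p * q + (X - C c) * (derivative p * q - p * derivative q), q ^ 2,
    by simpa using hq, by simp [hp]; ring, ?_⟩
  have hz : _root_.dRat ((RatFunc.X - RatFunc.C c) ^ n)
      = RatFunc.C (n : ℂ) * (RatFunc.X - RatFunc.C c) ^ (n - 1) := by
    rw [Derivation.leibniz_zpow]
    simp
  rw [Derivation.leibniz, hz, dRat_eq_ratDeriv, ratDeriv_div p hq0]
  simp only [smul_eq_mul, map_add, map_mul, map_sub, map_pow, RatFunc.algebraMap_X,
    RatFunc.algebraMap_C]
  rw [zpow_sub_one₀ hX]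
  field_simp
  ring

theorem unique (hf : HasLead c n m f) (hg : HasLead c n e f) : m = e := by
  obtain ⟨p, q, hq, hp, rfl⟩ := hf
  obtain ⟨p', q', hq', hp', h⟩ := hg
  have h1 := algebraMap_ne_zero_of_eval_ne_zero hq
  have h2 := algebraMap_ne_zero_of_eval_ne_zero hq'
  have h3 := mul_left_cancel₀ (zpow_ne_zero n (X_sub_C_ne_zero_ratFunc c)) h
  rw [div_eq_div_iff h1 h2, ← map_mul, ← map_mul] at h3
  have h4 := congrArg (eval c) (RatFunc.algebraMap_injective ℂ h3)
  rw [eval_mul, eval_mul, hp, hp'] at h4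
  have h5 : (m - e) * (q.eval c * q'.eval c) = 0 := by linear_combination h4
  exact sub_eq_zero.1 ((mul_eq_zero.1 h5).resolve_right (mul_ne_zero hq hq'))

theorem lower (hf : HasLead c n m f) (hk : k < n) : HasLead c k 0 f := by
  obtain ⟨p, q, hq, hp, rfl⟩ := hf
  obtain ⟨d, hd⟩ := Int.le.dest hk.le
  have hd0 : d ≠ 0 := by omega
  refine ⟨(X - C c) ^ d * p, q, hq, by simp [hd0], ?_⟩
  rw [← hd, zpow_add₀ (X_sub_C_ne_zero_ratFunc c), zpow_natCast, map_mul, map_pow,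
    algebraMap_X_sub_C]
  ring

theorem lower_le (hf : HasLead c n m f) (hk : k ≤ n) : ∃ e, HasLead c k e f := by
  rcases hk.eq_or_lt with rfl | h
  · exact ⟨m, hf⟩
  · exact ⟨0, hf.lower h⟩

theorem raise (hf : HasLead c n 0 f) : ∃ e, HasLead c (n + 1) e f := by
  obtain ⟨p, q, hq, hp, rfl⟩ := hf
  rw [zero_mul] at hp
  obtain ⟨r, rfl⟩ := dvd_iff_isRoot.2 hp
  refine ⟨r.eval c / q.eval c, r, q, hq, by field_simp, ?_⟩
  rw [zpow_add_one₀ (X_sub_C_ne_zero_ratFunc c), map_mul, algebraMap_X_sub_C]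
  ring

theorem le_of_ne_zero (hf : HasLead c n m f) (hm : m ≠ 0) (hg : HasLead c k e f) : k ≤ n := by
  by_contra! h
  exact hm (hf.unique (hg.lower h))

theorem exists_of_ne_zero (c : ℂ) (hf : f ≠ 0) : ∃ n m, m ≠ 0 ∧ HasLead c n m f := by
  obtain ⟨p, hp, hp'⟩ := exists_eq_pow_rootMultiplicity_mul_and_not_dvd f.num
    (RatFunc.num_ne_zero hf) c
  obtain ⟨q, hq, hq'⟩ := exists_eq_pow_rootMultiplicity_mul_and_not_dvd f.denom
    f.denom_ne_zero c
  rw [dvd_iff_isRoot, IsRoot.def] at hp' hq'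
  refine ⟨(rootMultiplicity c f.num : ℤ) - rootMultiplicity c f.denom, p.eval c / q.eval c,
    div_ne_zero hp' hq', p, q, hq', by field_simp, ?_⟩
  conv_lhs => rw [← RatFunc.num_div_denom f, hp, hq]
  rw [zpow_sub₀ (X_sub_C_ne_zero_ratFunc c), zpow_natCast, zpow_natCast]
  simp only [map_mul, map_pow, algebraMap_X_sub_C]
  ring

theorem of_definedAt (hf : DefinedAt f c) : HasLead c 0 (evalR f c) f := by
  refine ⟨f.num, f.denom, hf, ?_, by simp⟩
  rw [evalR_eq, div_mul_cancel₀ _ hf]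

theorem definedAt (hf : HasLead c 0 m f) : DefinedAt f c := by
  obtain ⟨p, q, hq, -, rfl⟩ := hf
  exact definedAt_iff.2 ⟨p, q, hq, by simp⟩

theorem exists_lower_bound (c : ℂ) (f : RatFunc ℂ) :
    ∃ N : ℤ, ∀ k ≤ N, ∃ m, HasLead c k m f := by
  by_cases hf : f = 0
  · exact ⟨0, fun k _ => ⟨0, hf ▸ zero c k⟩⟩
  · obtain ⟨n, m, -, h⟩ := exists_of_ne_zero c hf
    exact ⟨n, fun k hk => h.lower_le hk⟩

/-- A finite family of rational functions which do not all vanish has a common leading order. -/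
theorem exists_family {ι : Type*} [Finite ι] (c : ℂ) (q : ι → RatFunc ℂ) (i₀ : ι)
    (h0 : q i₀ ≠ 0) :
    ∃ (n : ℤ) (m : ι → ℂ), (∀ i, HasLead c n (m i) (q i)) ∧ ∃ i, m i ≠ 0 := by
  choose N hN using fun i => exists_lower_bound c (q i)
  obtain ⟨n₀, m₀, hm₀, hl⟩ := exists_of_ne_zero c h0
  obtain ⟨B, hB⟩ := (Set.finite_range N).bddBelow
  obtain ⟨n, hn, hmax⟩ := Int.exists_greatest_of_bdd
    (P := fun n => ∀ i, ∃ m, HasLead c n m (q i))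
    ⟨n₀, fun z hz => by obtain ⟨e, he⟩ := hz i₀; exact hl.le_of_ne_zero hm₀ he⟩
    ⟨B, fun i => hN i B (hB ⟨i, rfl⟩)⟩
  choose m hm using hn
  refine ⟨n, m, hm, ?_⟩
  by_contra! h
  have := hmax (n + 1) fun i => (h i ▸ hm i).raise
  omega

end HasLead

/-! ### Substitution into rational functions -/

/-- Substitution of a transcendental rational function `u` for `X`. -/
def substRat (u : RatFunc ℂ) (hu : Transcendental ℂ u) : RatFunc ℂ →ₐ[ℂ] RatFunc ℂ :=
  RatFunc.liftAlgHom (aeval u) (nonZeroDivisors_le_comap_nonZeroDivisors_of_injective _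
    (transcendental_iff_injective.1 hu))

section substRat

variable {u : RatFunc ℂ} (hu : Transcendental ℂ u)

theorem substRat_div (p q : ℂ[X]) :
    substRat u hu (algebraMap ℂ[X] (RatFunc ℂ) p / algebraMap ℂ[X] (RatFunc ℂ) q) =
      aeval u p / aeval u q :=
  RatFunc.liftAlgHom_apply_div _ _ _ _

theorem substRat_algebraMap (p : ℂ[X]) :
    substRat u hu (algebraMap ℂ[X] (RatFunc ℂ) p) = aeval u p := by
  simpa using substRat_div hu p 1

theorem substRat_X : substRat u hu RatFunc.X = u := by
  simpa using substRat_algebraMap hu X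

theorem substRat_C (a : ℂ) : substRat u hu (RatFunc.C a) = RatFunc.C a := by
  simpa using substRat_algebraMap hu (C a)

theorem dRat_substRat (f : RatFunc ℂ) :
    dRat (substRat u hu f) = substRat u hu (dRat f) * dRat u := by
  induction f using RatFunc.induction_on with | _ p q hq =>
  have h : aeval u q ≠ 0 := (transcendental_iff_injective.1 hu).ne_iff' (map_zero _) |>.2 hq
  rw [dRat_eq_ratDeriv (_ / _), ratDeriv_div _ hq, substRat_div, substRat_div,
    dRat.leibniz_div, dRat.map_aeval, dRat.map_aeval]
  simp only [smul_eq_mul, map_sub, map_mul, map_pow]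
  field_simp

/-- Values of a substitution. -/
theorem HasLead.substRat {t m a : ℂ} {f : RatFunc ℂ} (hut : HasLead t 0 a u)
    (hf : HasLead a 0 m f) : HasLead t 0 m (substRat u hu f) := by
  have key (p : ℂ[X]) : HasLead t 0 (p.eval a) (aeval u p) := by
    induction p using Polynomial.induction_on' with
    | add p q hp hq => simpa using hp.add hq
    | monomial n b =>
      induction n with
      | zero => simpa using HasLead.const t b
      | succ n ih =>
        have := ih.mul hut
        simp only [eval_monomial, aeval_monomial, add_zero] at this ⊢
        simpa [pow_succ, mul_assoc] using this
  obtain ⟨p, q, hq, hp, rfl⟩ := hf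
  have := (key p).mul ((key q).inv hq)
  rw [zpow_zero, one_mul, substRat_div, div_eq_mul_inv]
  rw [hp] at this
  simpa [hq] using this

end substRat

theorem transcendental_X_inv : Transcendental ℂ (RatFunc.X⁻¹ : RatFunc ℂ) := fun h =>
  RatFunc.transcendental_X (K := ℂ) (by simpa using h.inv)

theorem transcendental_neg_X : Transcendental ℂ (-RatFunc.X : RatFunc ℂ) := fun h =>
  RatFunc.transcendental_X (K := ℂ) (by simpa using h.neg)

/-- The substitution `X ↦ X⁻¹`. -/
abbrev invSubst : RatFunc ℂ →ₐ[ℂ] RatFunc ℂ := substRat RatFunc.X⁻¹ transcendental_X_inv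

/-- The substitution `X ↦ -X`. -/
abbrev negSubst : RatFunc ℂ →ₐ[ℂ] RatFunc ℂ := substRat (-RatFunc.X) transcendental_neg_X

theorem invSubst_dRat (f : RatFunc ℂ) :
    invSubst (dRat f) = -RatFunc.X ^ 2 * dRat (invSubst f) := by
  have hX := RatFunc.X_ne_zero (K := ℂ)
  rw [dRat_substRat, dRat.leibniz_inv, dRat_X, smul_eq_mul]
  generalize invSubst (dRat f) = g
  field_simp

theorem negSubst_dRat (f : RatFunc ℂ) : dRat (negSubst f) = -negSubst (dRat f) := by
  rw [dRat_substRat, map_neg, dRat_X, mul_neg, mul_one]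

theorem HasLead.negSubst {c m : ℂ} {n : ℤ} {f : RatFunc ℂ} (hf : HasLead (-c) n m f) :
    HasLead c n ((-1) ^ n * m) (negSubst f) := by
  have h1 : HasLead c 0 (-c) (-RatFunc.X) := (HasLead.ratX c).neg
  have h2 := hf.mul (HasLead.zpow_X_sub_C (-c) (-n))
  rw [mul_one, add_neg_cancel] at h2
  have h3 := (HasLead.substRat transcendental_neg_X h1 h2).mul
    ((HasLead.zpow_X_sub_C c n).C_mul ((-1) ^ n))
  rw [map_mul, map_zpow₀, map_sub, substRat_X, substRat_C, zero_add] at h3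
  have hX := X_sub_C_ne_zero_ratFunc c
  have h4 : (-RatFunc.X - RatFunc.C (-c)) = -(RatFunc.X - RatFunc.C c) := by
    rw [map_neg]; ring
  convert h3 using 1
  · ring
  · have h5 : (RatFunc.X - RatFunc.C c) ^ (-n) * (RatFunc.X - RatFunc.C c) ^ n = 1 := by
      rw [← zpow_add₀ hX]; simp
    have h6 : (-1 : RatFunc ℂ) ^ (-n) * (-1) ^ n = 1 := by
      rw [← zpow_add₀ (by simp)]; simp
    change _root_.negSubst f = _root_.negSubst f * _ * _
    generalize _root_.negSubst f = g
    rw [h4, neg_eq_neg_one_mul, mul_zpow, map_zpow₀, map_neg, map_one]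
    linear_combination (-g) * h5 -
      g * (RatFunc.X - RatFunc.C c) ^ (-n) * (RatFunc.X - RatFunc.C c) ^ n * h6

/-! ### Leading terms at infinity -/

/-- `f = m * t ^ n + o(t ^ n)` as `t → ∞` (the coefficient `m` may vanish). -/
def LeadInf (n : ℤ) (m : ℂ) (f : RatFunc ℂ) : Prop := HasLead 0 (-n) m (invSubst f)

namespace LeadInf

variable {n k : ℤ} {m e : ℂ} {f g : RatFunc ℂ}

theorem add (hf : LeadInf n m f) (hg : LeadInf n e g) : LeadInf n (m + e) (f + g) := by
  simpa [LeadInf] using HasLead.add hf hg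

theorem sub (hf : LeadInf n m f) (hg : LeadInf n e g) : LeadInf n (m - e) (f - g) := by
  simpa [LeadInf] using HasLead.sub hf hg

theorem neg (hf : LeadInf n m f) : LeadInf n (-m) (-f) := by
  simpa [LeadInf] using HasLead.neg hf

theorem mul (hf : LeadInf n m f) (hg : LeadInf k e g) : LeadInf (n + k) (m * e) (f * g) := by
  have := HasLead.mul hf hg
  rw [← map_mul, ← neg_add] at this
  exact this

theorem inv (hf : LeadInf n m f) (hm : m ≠ 0) : LeadInf (-n) m⁻¹ f⁻¹ := by
  simpa [LeadInf] using HasLead.inv hf hm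

theorem const (a : ℂ) : LeadInf 0 a (RatFunc.C a) := by
  simpa [LeadInf, substRat_C] using HasLead.const 0 a

theorem ratX : LeadInf 1 1 RatFunc.X := by
  simpa [LeadInf, substRat_X] using HasLead.zpow_X_sub_C 0 (-1)

theorem zero (n : ℤ) : LeadInf n 0 0 := by
  simpa [LeadInf] using HasLead.zero 0 (-n)

theorem C_mul (a : ℂ) (hf : LeadInf n m f) : LeadInf n (a * m) (RatFunc.C a * f) := by
  simpa using (const a).mul hf

theorem sum {ι : Type*} {s : Finset ι} {m : ι → ℂ} {f : ι → RatFunc ℂ}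
    (h : ∀ i ∈ s, LeadInf n (m i) (f i)) : LeadInf n (∑ i ∈ s, m i) (∑ i ∈ s, f i) := by
  simpa [LeadInf] using HasLead.sum h

theorem dRat (hf : LeadInf n m f) : LeadInf (n - 1) (n * m) (dRat f) := by
  have h : HasLead 0 2 1 (RatFunc.X ^ 2) := by
    simpa using HasLead.zpow_X_sub_C 0 2
  have := h.neg.mul (HasLead.dRat hf)
  rw [← invSubst_dRat] at this
  rw [LeadInf]
  convert this using 1
  · ring
  · push_cast; ring

theorem unique (hf : LeadInf n m f) (hg : LeadInf n e f) : m = e := HasLead.unique hf hg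

theorem raise (hf : LeadInf n m f) (hk : n < k) : LeadInf k 0 f :=
  HasLead.lower hf (neg_lt_neg hk)

theorem raise_le (hf : LeadInf n m f) (hk : n ≤ k) : ∃ e, LeadInf k e f :=
  HasLead.lower_le hf (neg_le_neg hk)

theorem lower (hf : LeadInf n 0 f) : ∃ e, LeadInf (n - 1) e f := by
  obtain ⟨e, he⟩ := HasLead.raise hf
  exact ⟨e, by rwa [LeadInf, neg_sub, sub_eq_neg_add]⟩

theorem exists_of_ne_zero (hf : f ≠ 0) : ∃ n m, m ≠ 0 ∧ LeadInf n m f := by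
  obtain ⟨n, m, hm, h⟩ := HasLead.exists_of_ne_zero 0
    ((map_ne_zero_iff _ (RingHom.injective invSubst.toRingHom)).2 hf)
  exact ⟨-n, m, hm, by rw [LeadInf, neg_neg]; exact h⟩

theorem exists_family {ι : Type*} [Finite ι] (q : ι → RatFunc ℂ) (i₀ : ι) (h0 : q i₀ ≠ 0) :
    ∃ (n : ℤ) (m : ι → ℂ), (∀ i, LeadInf n (m i) (q i)) ∧ ∃ i, m i ≠ 0 := by
  obtain ⟨n, m, h, hm⟩ := HasLead.exists_family 0 (fun i => invSubst (q i)) i₀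
    ((map_ne_zero_iff _ (RingHom.injective invSubst.toRingHom)).2 h0)
  exact ⟨-n, m, fun i => by rw [LeadInf, neg_neg]; exact h i, hm⟩

theorem eventually_eq (hf : LeadInf n m f) : ∃ h : ℂ → ℂ, Tendsto h (𝓝 0) (𝓝 m) ∧
    ∀ᶠ t in Bornology.cobounded ℂ, evalR f t = t ^ n * h t⁻¹ := by
  obtain ⟨p, q, hq, hp, hpq⟩ := hf
  refine ⟨fun s => p.eval s / q.eval s, ?_, ?_⟩
  · have := (p.continuous.tendsto 0).div (q.continuous.tendsto 0) hq
    rw [hp, mul_div_cancel_right₀ _ hq] at this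
    exact this
  · have hq' : ∀ᶠ s in 𝓝 (0 : ℂ), q.eval s ≠ 0 := q.continuous.continuousAt.eventually_ne hq
    have h1 := tendsto_inv₀_cobounded.eventually hq'
    have h2 := Bornology.le_cofinite ℂ (eventually_definedAt f)
    have h3 : ∀ᶠ t in Bornology.cobounded ℂ, t ≠ 0 :=
      Bornology.le_cofinite ℂ (by simp)
    filter_upwards [h1, h2, h3] with t h1 h2 h3
    have hX : HasLead t⁻¹ 0 t RatFunc.X⁻¹ := by
      simpa using (HasLead.ratX t⁻¹).inv (inv_ne_zero h3)
    have h4 := HasLead.substRat transcendental_X_inv hX (HasLead.of_definedAt h2)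
    change HasLead _ _ _ (invSubst f) at h4
    rw [hpq] at h4
    have h5 : HasLead t⁻¹ 0 (p.eval t⁻¹ / q.eval t⁻¹)
      (algebraMap ℂ[X] (RatFunc ℂ) p / algebraMap ℂ[X] (RatFunc ℂ) q) :=
      ⟨p, q, h1, by rw [div_mul_cancel₀ _ h1], by simp⟩
    have h6 (k : ℤ) : HasLead t⁻¹ 0 (t ^ (-k)) ((RatFunc.X - RatFunc.C 0) ^ k) := by
      rw [map_zero, sub_zero]
      have h7 := HasLead.ratX t⁻¹
      have h8 (j : ℕ) : HasLead t⁻¹ 0 (t ^ (-j : ℤ)) (RatFunc.X ^ j) := by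
        induction j with
        | zero => simpa using HasLead.const t⁻¹ 1
        | succ j ih =>
          have := ih.mul h7
          rw [pow_succ]
          convert this using 1
          rw [add_zero]
          rw [← zpow_neg_one, ← zpow_add₀ h3]
          push_cast
          ring_nf
      obtain ⟨j, rfl | rfl⟩ := k.eq_nat_or_neg
      · simpa using h8 j
      · have := (h8 j).inv (zpow_ne_zero _ h3)
        simpa using this
    have h7 := (h6 (-n)).mul h5
    rw [neg_neg] at h7
    exact h4.unique h7

theorem poleAtInfty (hf : LeadInf n m f) (hm : m ≠ 0) (hn : 0 < n) : PoleAtInfty f := by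
  obtain ⟨h, hh, he⟩ := hf.eventually_eq
  have h1 : Tendsto (fun t : ℂ => ‖h t⁻¹‖) (Bornology.cobounded ℂ) (𝓝 ‖m‖) :=
    (hh.comp tendsto_inv₀_cobounded).norm
  obtain ⟨j, rfl⟩ := Int.eq_ofNat_of_zero_le hn.le
  have hj : j ≠ 0 := by rintro rfl; simp at hn
  have h2 : Tendsto (fun t : ℂ => ‖t‖ ^ j) (Bornology.cobounded ℂ) atTop :=
    (tendsto_pow_atTop hj).comp tendsto_norm_cobounded_atTop
  refine (h2.atTop_mul_pos (norm_pos_iff.2 hm) h1).congr' ?_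
  filter_upwards [he] with t ht
  rw [ht]; simp

theorem holoAtInfty (hf : LeadInf n m f) (hn : n ≤ 0) : HoloAtInfty f := by
  obtain ⟨e, he⟩ := hf.raise_le hn
  obtain ⟨h, hh, he⟩ := he.eventually_eq
  have h1 : Tendsto (fun t : ℂ => ‖h t⁻¹‖) (Bornology.cobounded ℂ) (𝓝 ‖e‖) :=
    (hh.comp tendsto_inv₀_cobounded).norm
  refine (h1.congr' ?_).isBoundedUnder_le
  filter_upwards [he] with t ht
  rw [ht]; simp

end LeadInf

theorem PoleAtInfty.not_holoAtInfty {f : RatFunc ℂ} (h : PoleAtInfty f) : ¬ HoloAtInfty f :=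
  fun h' => not_isBoundedUnder_of_tendsto_atTop h h'

theorem PoleAtInfty.exists_leadInf {f : RatFunc ℂ} (h : PoleAtInfty f) :
    ∃ n m, m ≠ 0 ∧ 0 < n ∧ LeadInf n m f := by
  have hf : f ≠ 0 := by
    rintro rfl
    exact h.not_holoAtInfty ((LeadInf.zero 0).holoAtInfty le_rfl)
  obtain ⟨n, m, hm, hl⟩ := LeadInf.exists_of_ne_zero hf
  refine ⟨n, m, hm, ?_, hl⟩
  by_contra! hn
  exact h.not_holoAtInfty (hl.holoAtInfty hn)

theorem HoloAtInfty.exists_leadInf {f : RatFunc ℂ} (h : HoloAtInfty f) : ∃ m, LeadInf 0 m f := by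
  by_cases hf : f = 0
  · exact ⟨0, hf ▸ LeadInf.zero 0⟩
  obtain ⟨n, m, hm, hl⟩ := LeadInf.exists_of_ne_zero hf
  refine hl.raise_le ?_
  by_contra! hn
  exact (hl.poleAtInfty hm hn).not_holoAtInfty h

/-! ### The dressing chain -/

/-- The difference of the two sides of the `i`-th ODE of `A₅(α)`. -/
def odeDefect (α : Fin 6 → ℂ) (f : Fin 6 → RatFunc ℂ) (i : Fin 6) : RatFunc ℂ :=
  RatFunc.C (1 / 2) * RatFunc.X * dRat (f i) -
    (f i * (f (i + 1) * f (i + 2) + f (i + 1) * f (i + 4) + f (i + 3) * f (i + 4)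
        - f (i + 2) * f (i + 3) - f (i + 2) * f (i + 5) - f (i + 4) * f (i + 5))
      + RatFunc.C (1 / 2 - α (i + 2) - α (i + 4)) * f i
      + RatFunc.C (α i) * (f (i + 2) + f (i + 4)))

/-- The ODEs of `A₅(α)` as identities between rational functions. -/
theorem isA5Solution_iff (α : Fin 6 → ℂ) (f : Fin 6 → RatFunc ℂ) :
    IsA5Solution α f ↔ f 0 + f 2 + f 4 = RatFunc.X ∧ f 1 + f 3 + f 5 = RatFunc.X ∧
      ∀ i, odeDefect α f i = 0 := by
  have key (t : ℂ) (ht : ∀ j, DefinedAt (f j) t) (i : Fin 6) :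
      evalR (odeDefect α f i) t =
      t / 2 * deriv (evalR (f i)) t - (
      evalR (f i) t *
        (evalR (f (i + 1)) t * evalR (f (i + 2)) t
          + evalR (f (i + 1)) t * evalR (f (i + 4)) t
          + evalR (f (i + 3)) t * evalR (f (i + 4)) t
          - evalR (f (i + 2)) t * evalR (f (i + 3)) t
          - evalR (f (i + 2)) t * evalR (f (i + 5)) t
          - evalR (f (i + 4)) t * evalR (f (i + 5)) t)
      + (1 / 2 - α (i + 2) - α (i + 4)) * evalR (f i) t
      + α i * (evalR (f (i + 2)) t + evalR (f (i + 4)) t)) := by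
    have hL (j) := HasLead.of_definedAt (ht j)
    have hD : HasLead t 0 (deriv (evalR (f i)) t) (dRat (f i)) := by
      rw [deriv_evalR (ht i)]; exact HasLead.of_definedAt (ht i).dRat
    have hm {x y : ℂ} {a b : RatFunc ℂ} (ha : HasLead t 0 x a) (hb : HasLead t 0 y b) :
      HasLead t 0 (x * y) (a * b) := ha.mul hb
    have := (hm (hm (HasLead.const t (1 / 2)) (HasLead.ratX t)) hD).sub
      (((hm (hL i) ((((((hm (hL (i + 1)) (hL (i + 2))).add (hm (hL (i + 1)) (hL (i + 4)))).add
        (hm (hL (i + 3)) (hL (i + 4)))).sub (hm (hL (i + 2)) (hL (i + 3)))).sub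
        (hm (hL (i + 2)) (hL (i + 5)))).sub (hm (hL (i + 4)) (hL (i + 5))))).add
        (hm (HasLead.const t (1 / 2 - α (i + 2) - α (i + 4))) (hL i))).add
        (hm (HasLead.const t (α i)) ((hL (i + 2)).add (hL (i + 4)))))
    rw [odeDefect, (HasLead.of_definedAt this.definedAt).unique this]
    ring
  refine and_congr_right fun _ => and_congr_right fun _ => ⟨fun h i => ?_, fun h t ht i => ?_⟩
  · apply eq_of_evalR_eventuallyEq
    filter_upwards [eventually_all.2 fun j => eventually_definedAt (f j)] with t ht
    rw [key t ht i, sub_eq_zero.2 (h t ht i)]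
    simpa using (evalR_C 0 t).symm
  · rw [← sub_eq_zero, ← key t ht i, h i]
    simpa using evalR_C 0 t

/-- The periodic dressing chain of length six with parameters `α`. -/
structure IsDressingChain (α : Fin 6 → ℂ) (q : Fin 6 → RatFunc ℂ) : Prop where
  chain : ∀ i, RatFunc.C (1 / 2) * dRat (q i + q (i + 1)) =
    RatFunc.C (α i) + q (i + 1) ^ 2 - q i ^ 2
  sum : q 0 + q 1 + q 2 + q 3 + q 4 + q 5 = RatFunc.X

theorem C_half : RatFunc.C (1 / 2 : ℂ) = (1 / 2 : RatFunc ℂ) := by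
  rw [map_div₀, map_one, map_ofNat]

theorem IsA5Solution.exists_isDressingChain {α : Fin 6 → ℂ} {f : Fin 6 → RatFunc ℂ}
    (hsum : α 0 + α 1 + α 2 + α 3 + α 4 + α 5 = 1) (h : IsA5Solution α f) :
    ∃ q, IsDressingChain α q ∧ ∀ i, f i = q i + q (i + 1) := by
  obtain ⟨h0, h1, hode⟩ := (isA5Solution_iff α f).1 h
  have hX := RatFunc.X_ne_zero (K := ℂ)
  have hs := congrArg (RatFunc.C (K := ℂ)) hsum
  simp only [map_add, map_one] at hs
  simp only [odeDefect, map_sub, C_half] at hode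
  set g : Fin 6 → RatFunc ℂ := fun i =>
    (f (i + 1) * f (i + 2) + f (i + 1) * f (i + 4) + f (i + 3) * f (i + 4)
          - f (i + 2) * f (i + 3) - f (i + 2) * f (i + 5) - f (i + 4) * f (i + 5) + 
      1 / 2 - RatFunc.C (α i) - RatFunc.C (α (i + 2)) - RatFunc.C (α (i + 4))) / RatFunc.X with hg
  have hE (i : Fin 6) : f i + f (i + 2) + f (i + 4) = RatFunc.X := by
    fin_cases i <;> simp only [Fin.reduceFinMk, Fin.reduceAdd, Fin.zero_eta, zero_add, Fin.mk_one] <;>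
      first | linear_combination h0 | linear_combination h1
  have hA (i : Fin 6) : RatFunc.C (α i) + RatFunc.C (α (i + 1)) + RatFunc.C (α (i + 2)) +
      RatFunc.C (α (i + 3)) + RatFunc.C (α (i + 4)) + RatFunc.C (α (i + 5)) = 1 := by
    fin_cases i <;> simp only [Fin.reduceFinMk, Fin.reduceAdd, Fin.zero_eta, zero_add, Fin.mk_one] <;>
      linear_combination hs
  have hg1 (i) : 1 / 2 * dRat (f i) = f i * g i + RatFunc.C (α i) := by
    have h2 := hode i
    have hE' := hE i
    apply mul_left_cancel₀ hX
    simp only [hg]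
    field_simp
    field_simp at h2
    linear_combination h2 + 2 * RatFunc.C (α i) * hE'
  have hg2 (i) : f (i + 1) - f i = g i + g (i + 1) := by
    have e1 := hE i
    have e2 := hE (i + 1)
    have e3 := hA i
    simp only [hg]
    simp only [add_assoc, Fin.reduceAdd] at e2 e3 ⊢
    rw [add_zero]
    field_simp
    linear_combination (-2 * f (i + 1)) * e1 + 2 * f i * e2 + 2 * e3
  clear_value g
  have hq (i) : (f i - g i) / 2 + (f (i + 1) - g (i + 1)) / 2 = f i := by
    linear_combination hg2 i / 2
  refine ⟨fun i => (f i - g i) / 2, ⟨fun i => ?_, ?_⟩, fun i => (hq i).symm⟩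
  · rw [hq i, C_half, hg1 i]
    linear_combination (-1 / 4 : RatFunc ℂ) * (f i + (f (i + 1) - g (i + 1)) + g i) * hg2 i
  · have e0 := hq 0
    have e2 := hq 2
    have e4 := hq 4
    simp only [Fin.reduceAdd, zero_add] at e0 e2 e4
    linear_combination e0 + e2 + e4 + h0

theorem IsDressingChain.isA5Solution {α : Fin 6 → ℂ} {q : Fin 6 → RatFunc ℂ}
    (h : IsDressingChain α q) : IsA5Solution α (fun i => q i + q (i + 1)) := by
  obtain ⟨hc, hs⟩ := h
  refine (isA5Solution_iff _ _).2 ⟨?_, ?_, fun i => ?_⟩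
  · simp only [Fin.reduceAdd]; linear_combination hs
  · simp only [Fin.reduceAdd]; linear_combination hs
  have hX (i : Fin 6) : q i + q (i + 1) + q (i + 2) + q (i + 3) + q (i + 4) + q (i + 5)
      = RatFunc.X := by
    fin_cases i <;> simp only [Fin.reduceFinMk, Fin.reduceAdd, Fin.zero_eta, zero_add,
      Fin.mk_one] <;> linear_combination hs
  have h0 := hc i
  have h2 := hc (i + 2)
  have h4 := hc (i + 4)
  replace hs := hX i
  clear hX hc
  have hd := congrArg dRat hs
  simp only [odeDefect, C_half, map_sub] at *
  simp only [add_assoc, Fin.reduceAdd, add_zero, map_add, dRat_X] at *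
  rw [← hs]
  generalize q i = q0 at *
  generalize q (i + 1) = q1 at *
  generalize q (i + 2) = q2 at *
  generalize q (i + 3) = q3 at *
  generalize q (i + 4) = q4 at *
  generalize q (i + 5) = q5 at *
  linear_combination (q0 + q1 + q2 + q3 + q4 + q5) * h0 - (q0 + q1) * (h0 + h2 + h4) + (q0 + q1) / 2 * hd

/-! ### Behaviour at infinity -/

/-- The ring of rational functions holomorphic at infinity. -/
def bddInf : Subring (RatFunc ℂ) where
  carrier := {f | ∃ m, LeadInf 0 m f}
  mul_mem' := fun ⟨_, hf⟩ ⟨_, hg⟩ => ⟨_, hf.mul hg⟩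
  add_mem' := fun ⟨_, hf⟩ ⟨_, hg⟩ => ⟨_, hf.add hg⟩
  neg_mem' := fun ⟨_, hf⟩ => ⟨_, hf.neg⟩
  one_mem' := ⟨1, by simpa using LeadInf.const 1⟩
  zero_mem' := ⟨0, LeadInf.zero 0⟩

theorem LeadInf.mem_bddInf {n : ℤ} {m : ℂ} {f : RatFunc ℂ} (h : LeadInf n m f) (hn : n ≤ 0) :
    f ∈ bddInf := h.raise_le hn

theorem C_mem_bddInf (a : ℂ) : RatFunc.C a ∈ bddInf := ⟨a, LeadInf.const a⟩

/-- The sign `±1` encoded by a Boolean. -/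
def sgn (b : Bool) : ℂ := if b then 1 else -1

@[simp] theorem sgn_true : sgn true = 1 := rfl

@[simp] theorem sgn_false : sgn false = -1 := rfl

theorem sgn_mul_self (b : Bool) : sgn b * sgn b = 1 := by cases b <;> simp

/-- The components `q i` are asymptotic to `± t / 2` at infinity, with four plus signs. -/
structure HasSigns (σ : Fin 6 → Bool) (q : Fin 6 → RatFunc ℂ) : Prop where
  card : (Finset.univ.filter fun i => σ i = true).card = 4
  mem : ∀ i, q i - RatFunc.C (sgn (σ i) / 2) * RatFunc.X ∈ bddInf

theorem sum_sgn (σ : Fin 6 → Bool) (h : (Finset.univ.filter fun i => σ i = true).card = 4) :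
    sgn (σ 0) + sgn (σ 1) + sgn (σ 2) + sgn (σ 3) + sgn (σ 4) + sgn (σ 5) = 2 := by
  have h1 : ∑ i, sgn (σ i) = 2 * ((Finset.univ.filter fun i => σ i = true).card : ℂ) - 6 := by
    have (i : Fin 6) : sgn (σ i) = 2 * (if σ i = true then 1 else 0) - 1 := by
      cases σ i <;> norm_num
    simp_rw [this, Finset.sum_sub_distrib, ← Finset.mul_sum, Finset.sum_boole]
    simp
  rw [h, Fin.sum_univ_six] at h1
  rw [h1]; norm_num

theorem IsDressingChain.mul_sub {α : Fin 6 → ℂ} {q : Fin 6 → RatFunc ℂ}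
    (h : IsDressingChain α q) (i : Fin 6) : (q i + q (i + 1)) * (q (i + 1) - q i) =
      RatFunc.C (1 / 2) * dRat (q i + q (i + 1)) - RatFunc.C (α i) := by
  rw [h.chain i]; ring

theorem IsDressingChain.sub_mem_of_pole {α : Fin 6 → ℂ} {q : Fin 6 → RatFunc ℂ}
    (h : IsDressingChain α q) {i : Fin 6} (hp : PoleAtInfty (q i + q (i + 1))) :
    q (i + 1) - q i ∈ bddInf := by
  obtain ⟨n, m, hm, hn, hl⟩ := hp.exists_leadInf
  have h0 : q i + q (i + 1) ≠ 0 := fun h0 => hm (hl.unique (h0 ▸ LeadInf.zero n))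
  obtain ⟨e, he⟩ := (LeadInf.const (α i)).raise_le (k := n - 1) (by omega)
  have h1 := (hl.inv hm).mul ((hl.dRat.C_mul (1 / 2)).sub he)
  rw [← h.mul_sub i, inv_mul_cancel_left₀ h0] at h1
  exact h1.mem_bddInf (by omega)

@[elab_as_elim]
theorem cyclic_induction {P : Fin 6 → Prop} (zero : P 0) (step : ∀ k, P k → P (k + 1))
    (k : Fin 6) : P k := by
  have h1 := step _ zero
  have h2 := step _ h1
  have h3 := step _ h2
  have h4 := step _ h3
  have h5 := step _ h4
  fin_cases k
  exacts [zero, h1, h2, h3, h4, h5]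

theorem hasSigns_of_differences {q : Fin 6 → RatFunc ℂ} {i : Fin 6} {p : Fin 6 → Bool}
    (hsum : q 0 + q 1 + q 2 + q 3 + q 4 + q 5 = RatFunc.X)
    (hp : (Finset.univ.filter fun i => p i = true).card = 4)
    (h : ∀ k, q (i + k + 1) - RatFunc.C (sgn (p k) * sgn (p (k + 1))) * q (i + k) ∈ bddInf) :
    ∃ σ, HasSigns σ q := by
  have key (k : Fin 6) : q (i + k) - RatFunc.C (sgn (p k) * sgn (p 0)) * q i ∈ bddInf := by
    induction k using cyclic_induction with
    | zero => simp [sgn_mul_self, bddInf.zero_mem, -map_mul]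
    | step k ih =>
      have := bddInf.add_mem (h k) (bddInf.mul_mem
        (C_mem_bddInf (sgn (p k) * sgn (p (k + 1)))) ih)
      convert this using 1
      rw [← add_assoc, mul_sub, ← mul_assoc, ← map_mul]
      have e : sgn (p k) * sgn (p (k + 1)) * (sgn (p k) * sgn (p 0)) =
          sgn (p (k + 1)) * sgn (p 0) := by
        linear_combination sgn (p (k + 1)) * sgn (p 0) * sgn_mul_self (p k)
      rw [e]
      ring
  have hX : RatFunc.X - RatFunc.C (2 * sgn (p 0)) * q i ∈ bddInf := by
    have h1 := sum_mem (S := bddInf) (t := Finset.univ) fun k _ => key k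
    rw [Finset.sum_sub_distrib, ← Finset.sum_mul, ← map_sum, ← Finset.sum_mul,
      Fin.sum_univ_six fun k => sgn (p k), sum_sgn p hp,
      show ∑ k, q (i + k) = ∑ k, q k from Equiv.sum_comp (Equiv.addLeft i) q,
      Fin.sum_univ_six, hsum] at h1
    exact h1
  have hi : q i - RatFunc.C (sgn (p 0) / 2) * RatFunc.X ∈ bddInf := by
    have h1 := bddInf.mul_mem (C_mem_bddInf (-(sgn (p 0) / 2))) hX
    convert h1 using 1
    rw [mul_sub, ← mul_assoc, ← map_mul, show -(sgn (p 0) / 2) * (2 * sgn (p 0)) = -1 by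
      linear_combination -sgn_mul_self (p 0), map_neg, map_neg, map_one]
    ring
  refine ⟨fun j => p (j - i), ?_, fun j => ?_⟩
  · rw [← hp, Finset.card_filter, Finset.card_filter]
    exact Equiv.sum_comp (Equiv.subRight i) fun j => if p j = true then 1 else 0
  · have h1 := bddInf.add_mem (key (j - i))
      (bddInf.mul_mem (C_mem_bddInf (sgn (p (j - i)) * sgn (p 0))) hi)
    rw [add_sub_cancel] at h1
    convert h1 using 1
    rw [mul_sub, ← mul_assoc, ← map_mul, show sgn (p (j - i)) * sgn (p 0) * (sgn (p 0) / 2) =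
      sgn (p (j - i)) / 2 by linear_combination sgn (p (j - i)) / 2 * sgn_mul_self (p 0)]
    ring

theorem TypeA.exists_hasSigns {α : Fin 6 → ℂ} {q : Fin 6 → RatFunc ℂ}
    (h : IsDressingChain α q) (hA : TypeA fun i => q i + q (i + 1)) : ∃ σ, HasSigns σ q := by
  have hH (i) (h' : HoloAtInfty (q i + q (i + 1))) : q (i + 1) + q i ∈ bddInf := by
    rw [add_comm]; exact h'.exists_leadInf
  have hP (i) (h' : PoleAtInfty (q i + q (i + 1))) := h.sub_mem_of_pole h'
  obtain ⟨i, ⟨h0, h1, h2, h3, h4, h5⟩ | ⟨h0, h3, h1, h2, h4, h5⟩ | ⟨h0, h1, h2, h4, h3, h5⟩⟩ := hA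
  · refine hasSigns_of_differences (i := i) (p := ![true, true, true, false, true, false])
      h.sum (by decide) fun k => ?_
    fin_cases k
    · simpa using hP _ h0
    · simpa using hP _ h1
    · simpa using hH _ h2
    · simpa using hH _ h3
    · simpa using hH _ h4
    · simpa using hH _ h5
  · refine hasSigns_of_differences (i := i) (p := ![true, true, false, true, true, false])
      h.sum (by decide) fun k => ?_
    fin_cases k
    · simpa using hP _ h0
    · simpa using hH _ h1
    · simpa using hH _ h2
    · simpa using hP _ h3
    · simpa using hH _ h4
    · simpa using hH _ h5
  · refine hasSigns_of_differences (i := i) (p := ![true, true, true, true, false, false])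
      h.sum (by decide) fun k => ?_
    fin_cases k
    · simpa using hP _ h0
    · simpa using hP _ h1
    · simpa using hP _ h2
    · simpa using hH _ h3
    · simpa using hP _ h4
    · simpa using hH _ h5

theorem sign_pattern : ∀ σ : Fin 6 → Bool, (Finset.univ.filter fun i => σ i = true).card = 4 →
    ∃ i, (σ i = σ (i + 1) ∧ σ (i + 1) = σ (i + 2) ∧ σ (i + 2) ≠ σ (i + 3) ∧
        σ (i + 3) ≠ σ (i + 4) ∧ σ (i + 4) ≠ σ (i + 5) ∧ σ (i + 5) ≠ σ (i + 6)) ∨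
      (σ i = σ (i + 1) ∧ σ (i + 3) = σ (i + 4) ∧ σ (i + 1) ≠ σ (i + 2) ∧
        σ (i + 2) ≠ σ (i + 3) ∧ σ (i + 4) ≠ σ (i + 5) ∧ σ (i + 5) ≠ σ (i + 6)) ∨
      (σ i = σ (i + 1) ∧ σ (i + 1) = σ (i + 2) ∧ σ (i + 2) = σ (i + 3) ∧
        σ (i + 4) = σ (i + 5) ∧ σ (i + 3) ≠ σ (i + 4) ∧ σ (i + 5) ≠ σ (i + 6)) := by
  decide

theorem HasSigns.typeA {σ : Fin 6 → Bool} {q : Fin 6 → RatFunc ℂ} (h : HasSigns σ q) :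
    TypeA fun i => q i + q (i + 1) := by
  have hP (i j) (hij : σ i = σ j) : PoleAtInfty (q i + q j) := by
    obtain ⟨m, hm⟩ := bddInf.add_mem (h.mem i) (h.mem j)
    have := (hm.raise zero_lt_one).add (LeadInf.ratX.C_mul (sgn (σ i)))
    refine LeadInf.poleAtInfty (n := 1) (m := 0 + sgn (σ i) * 1) ?_ ?_ one_pos
    · convert this using 1
      have : RatFunc.C (sgn (σ j)) = 2 * RatFunc.C (sgn (σ j) / 2) := by
        rw [map_div₀, map_ofNat]; ring
      rw [hij, this]; ring
    · cases σ i <;> simp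
  have hH (i j) (hij : σ i ≠ σ j) : HoloAtInfty (q i + q j) := by
    obtain ⟨m, hm⟩ := bddInf.add_mem (h.mem i) (h.mem j)
    refine LeadInf.holoAtInfty (n := 0) (m := m) ?_ le_rfl
    convert hm using 1
    have : RatFunc.C (sgn (σ i) / 2) = - RatFunc.C (sgn (σ j) / 2) := by
      rw [← map_neg]; congr 1
      cases hi : σ i <;> cases hj : σ j <;> simp_all <;> ring
    rw [this]; ring
  obtain ⟨i, ⟨h0, h1, h2, h3, h4, h5⟩ | ⟨h0, h3, h1, h2, h4, h5⟩ | ⟨h0, h1, h2, h4, h3, h5⟩⟩ :=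
    sign_pattern σ h.card
  · refine ⟨i, Or.inl ⟨hP _ _ h0, ?_, ?_, ?_, ?_, ?_⟩⟩ <;> simp only [add_assoc, Fin.reduceAdd]
    exacts [hP _ _ h1, hH _ _ h2, hH _ _ h3, hH _ _ h4, hH _ _ h5]
  · refine ⟨i, Or.inr (Or.inl ⟨hP _ _ h0, ?_, ?_, ?_, ?_, ?_⟩)⟩ <;>
      simp only [add_assoc, Fin.reduceAdd]
    exacts [hP _ _ h3, hH _ _ h1, hH _ _ h2, hH _ _ h4, hH _ _ h5]
  · refine ⟨i, Or.inr (Or.inr ⟨hP _ _ h0, ?_, ?_, ?_, ?_, ?_⟩)⟩ <;>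
      simp only [add_assoc, Fin.reduceAdd]
    exacts [hP _ _ h1, hP _ _ h2, hP _ _ h4, hH _ _ h3, hH _ _ h5]

/-! ### Local analysis of the dressing chain -/

/-- The local form of one equation of the dressing chain. -/
def ChainAt (c : ℂ) (a b : RatFunc ℂ) : Prop :=
  DefinedAt (RatFunc.C (1 / 2) * dRat (a + b) + a ^ 2 - b ^ 2) c

theorem IsDressingChain.chainAt {α : Fin 6 → ℂ} {q : Fin 6 → RatFunc ℂ}
    (h : IsDressingChain α q) (c : ℂ) (i : Fin 6) : ChainAt c (q i) (q (i + 1)) := by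
  rw [ChainAt, h.chain i, show RatFunc.C (α i) + q (i + 1) ^ 2 - q i ^ 2 + q i ^ 2 - q (i + 1) ^ 2
    = RatFunc.C (α i) by ring]
  exact definedAt_C _ _

namespace ChainAt

variable {c w v w₁ w₂ w₃ w₄ w₅ w₆ : ℂ} {n : ℤ} {a b d g a₁ a₂ a₃ a₄ a₅ a₆ : RatFunc ℂ}

theorem remove (hda : ChainAt c d a) (hab : ChainAt c a b) (hbg : ChainAt c b g)
    (hr : DefinedAt (a + b) c) : ChainAt c d g := by
  have := ((DefinedAt.add hda hbg).add hab).sub hr.dRat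
  rw [ChainAt]
  convert this using 1
  simp only [map_add, C_half]
  ring

theorem lead_rel (h : ChainAt c a b) (hn : 1 ≤ n) (ha : HasLead c (-n) w a)
    (hb : HasLead c (-n) v b) : v = -w ∨ v = w - if n = 1 then 1 / 2 else 0 := by
  have h0 := (HasLead.of_definedAt h).lower (k := -n + -n) (by omega)
  have h1 := (ha.mul ha).sub (hb.mul hb)
  have hD := (ha.add hb).dRat.C_mul (1 / 2)
  have key : (w + v) * (w - v - if n = 1 then 1 / 2 else 0) = 0 := by
    split_ifs with hn1
    · subst hn1
      have := (hD.add h1).unique (e := 0) (by convert h0 using 1 <;> ring)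
      push_cast at this
      linear_combination this
    · have h2 := (hD.lower (k := -n + -n) (by omega)).add h1
      have := h2.unique (e := 0) (by convert h0 using 1; ring)
      linear_combination this
  rcases mul_eq_zero.1 key with h | h
  · left; linear_combination h
  · right; linear_combination -h

theorem add_of_flip (h : ChainAt c a b) (hn : 1 ≤ n) (ha : HasLead c (-n) w a)
    (hb : HasLead c (-n) (-w) b) (hw : w ≠ 0) : ∃ e, HasLead c n e (a + b) := by
  by_cases hs : a + b = 0
  · exact ⟨0, hs ▸ HasLead.zero c n⟩
  obtain ⟨k, e, he, hk⟩ := HasLead.exists_of_ne_zero c hs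
  refine hk.lower_le ?_
  by_contra! hkn
  have h1 := ha.add hb
  rw [add_neg_cancel] at h1
  obtain ⟨e', he'⟩ := h1.raise
  have hk0 : -n + 1 ≤ k := hk.le_of_ne_zero he he'
  have h2 := hk.mul (ha.sub hb)
  have h0 := (HasLead.of_definedAt h).lower (k := k + -n) (by omega)
  have hD := hk.dRat.C_mul (1 / 2)
  have hwe : w * e ≠ 0 := mul_ne_zero hw he
  rcases hn.eq_or_lt with rfl | hn
  · obtain rfl : k = 0 := by omega
    have := (hD.add h2).unique (e := 0) (by convert h0 using 1 <;> ring)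
    push_cast at this
    apply hwe
    linear_combination this / 2
  · have := ((hD.lower (k := k + -n) (by omega)).add h2).unique (e := 0)
      (by convert h0 using 1; ring)
    apply hwe
    linear_combination this / 2

theorem definedAt_of_hasLead {e : ℂ} (hn : 1 ≤ n) (h : HasLead c n e a) : DefinedAt a c :=
  (h.lower (k := 0) (by omega)).definedAt

theorem sum_four_of_flip (hn : 1 ≤ n) (l₁ : HasLead c (-n) w₁ a₁) (l₂ : HasLead c (-n) w₂ a₂)
    (l₃ : HasLead c (-n) w₃ a₃) (l₄ : HasLead c (-n) w₄ a₄) (n₁ : w₁ ≠ 0) (n₃ : w₃ ≠ 0)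
    (hs : w₁ + w₂ + w₃ + w₄ = 0) (h₁ : ChainAt c a₁ a₂) (h₃ : ChainAt c a₃ a₄)
    (hf : w₂ = -w₁) : ∃ e, HasLead c n e (a₁ + a₂ + a₃ + a₄) := by
  subst hf
  obtain rfl : w₄ = -w₃ := by linear_combination hs
  obtain ⟨e, he⟩ := h₁.add_of_flip hn l₁ l₂ n₁
  obtain ⟨e', he'⟩ := h₃.add_of_flip hn l₃ l₄ n₃
  exact ⟨_, by rw [add_assoc]; exact he.add he'⟩

theorem sum_four (hn : 1 ≤ n) (l₁ : HasLead c (-n) w₁ a₁) (l₂ : HasLead c (-n) w₂ a₂)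
    (l₃ : HasLead c (-n) w₃ a₃) (l₄ : HasLead c (-n) w₄ a₄)
    (n₁ : w₁ ≠ 0) (n₂ : w₂ ≠ 0) (n₃ : w₃ ≠ 0) (n₄ : w₄ ≠ 0)
    (hs : w₁ + w₂ + w₃ + w₄ = 0) (h₁ : ChainAt c a₁ a₂) (h₂ : ChainAt c a₂ a₃)
    (h₃ : ChainAt c a₃ a₄) (h₄ : ChainAt c a₄ a₁) :
    ∃ e, HasLead c n e (a₁ + a₂ + a₃ + a₄) := by
  rcases h₁.lead_rel hn l₁ l₂ with f₁ | f₁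
  · exact sum_four_of_flip hn l₁ l₂ l₃ l₄ n₁ n₃ hs h₁ h₃ f₁
  rcases h₂.lead_rel hn l₂ l₃ with f₂ | f₂
  · obtain ⟨e, he⟩ := sum_four_of_flip hn l₂ l₃ l₄ l₁ n₂ n₄ (by linear_combination hs) h₂ h₄ f₂
    exact ⟨e, by convert he using 1; ring⟩
  rcases h₃.lead_rel hn l₃ l₄ with f₃ | f₃
  · obtain ⟨e, he⟩ := sum_four_of_flip hn l₃ l₄ l₁ l₂ n₃ n₁ (by linear_combination hs) h₃ h₁ f₃
    exact ⟨e, by convert he using 1; ring⟩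
  rcases h₄.lead_rel hn l₄ l₁ with f₄ | f₄
  · obtain ⟨e, he⟩ := sum_four_of_flip hn l₄ l₁ l₂ l₃ n₄ n₂ (by linear_combination hs) h₄ h₂ f₄
    exact ⟨e, by convert he using 1; ring⟩
  exfalso
  have hδ : (if n = 1 then 1 / 2 else 0 : ℂ) = 0 := by
    linear_combination (f₁ + f₂ + f₃ + f₄) / 4
  rw [hδ] at f₁ f₂ f₃ f₄
  apply n₁
  linear_combination hs / 4 - f₂ / 4 - f₁ / 2 - f₃ / 4 - f₁ / 4 - f₂ / 4

theorem sum_six_of_flip (hn : 1 ≤ n) (l₁ : HasLead c (-n) w₁ a₁) (l₂ : HasLead c (-n) w₂ a₂)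
    (l₃ : HasLead c (-n) w₃ a₃) (l₄ : HasLead c (-n) w₄ a₄) (l₅ : HasLead c (-n) w₅ a₅)
    (l₆ : HasLead c (-n) w₆ a₆) (n₁ : w₁ ≠ 0) (n₃ : w₃ ≠ 0) (n₄ : w₄ ≠ 0) (n₅ : w₅ ≠ 0)
    (n₆ : w₆ ≠ 0) (hs : w₁ + w₂ + w₃ + w₄ + w₅ + w₆ = 0) (h₁ : ChainAt c a₁ a₂)
    (h₂ : ChainAt c a₂ a₃) (h₃ : ChainAt c a₃ a₄) (h₄ : ChainAt c a₄ a₅) (h₅ : ChainAt c a₅ a₆)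
    (h₆ : ChainAt c a₆ a₁) (hf : w₂ = -w₁) :
    ∃ e, HasLead c n e (a₁ + a₂ + a₃ + a₄ + a₅ + a₆) := by
  subst hf
  obtain ⟨e, he⟩ := h₁.add_of_flip hn l₁ l₂ n₁
  obtain ⟨e', he'⟩ := sum_four hn l₃ l₄ l₅ l₆ n₃ n₄ n₅ n₆ (by linear_combination hs) h₃ h₄ h₅
    (h₆.remove h₁ h₂ (definedAt_of_hasLead hn he))
  exact ⟨_, by convert he.add he' using 1; ring⟩

end ChainAt

/-- If no leading coefficient of a cyclic chain vanishes, the sum of its members vanishes to the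
order of their poles. -/
theorem exists_hasLead_sum {c : ℂ} {n : ℤ} {w : Fin 6 → ℂ} {q : Fin 6 → RatFunc ℂ} (hn : 1 ≤ n)
    (hl : ∀ i, HasLead c (-n) (w i) (q i)) (hw : ∀ i, w i ≠ 0)
    (hs : w 0 + w 1 + w 2 + w 3 + w 4 + w 5 = 0)
    (hc : ∀ i, ChainAt c (q i) (q (i + 1))) :
    ∃ e, HasLead c n e (q 0 + q 1 + q 2 + q 3 + q 4 + q 5) := by
  have rot (i : Fin 6) : w i + w (i + 1) + w (i + 2) + w (i + 3) + w (i + 4) + w (i + 5) = 0 ∧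
      q i + q (i + 1) + q (i + 2) + q (i + 3) + q (i + 4) + q (i + 5) =
        q 0 + q 1 + q 2 + q 3 + q 4 + q 5 := by
    fin_cases i <;> simp only [Fin.reduceFinMk, Fin.reduceAdd, Fin.zero_eta, zero_add,
      Fin.mk_one] <;> refine ⟨by linear_combination hs, ?_⟩ <;> first | trivial | ring
  by_cases hf : ∃ i, w (i + 1) = -w i
  · obtain ⟨i, hi⟩ := hf
    have h₁ := hc i
    have h₂ := hc (i + 1)
    have h₃ := hc (i + 2)
    have h₄ := hc (i + 3)
    have h₅ := hc (i + 4)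
    have h₆ := hc (i + 5)
    simp only [add_assoc i, Fin.reduceAdd, add_zero] at h₂ h₃ h₄ h₅ h₆
    have := ChainAt.sum_six_of_flip hn (hl _) (hl _) (hl _) (hl _) (hl _) (hl _) (hw _)
      (hw _) (hw _) (hw _) (hw _) (rot i).1 h₁ h₂ h₃ h₄ h₅ h₆ hi
    rwa [(rot i).2] at this
  · push Not at hf
    exfalso
    have f (i) := ((hc i).lead_rel hn (hl i) (hl _)).resolve_left (hf i)
    have f0 := f 0
    have f1 := f 1
    have f2 := f 2
    have f3 := f 3
    have f4 := f 4
    have f5 := f 5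
    simp only [Fin.reduceAdd, zero_add] at f0 f1 f2 f3 f4 f5
    have hδ : (if n = 1 then 1 / 2 else 0 : ℂ) = 0 := by
      linear_combination (f0 + f1 + f2 + f3 + f4 + f5) / 6
    rw [hδ] at f0 f1 f2 f3 f4 f5
    apply hw 0
    linear_combination (hs - 5 * f0 - 4 * f1 - 3 * f2 - 2 * f3 - f4) / 6

namespace IsDressingChain

variable {α : Fin 6 → ℂ} {q : Fin 6 → RatFunc ℂ} {c : ℂ} {n : ℤ} {w : Fin 6 → ℂ}

theorem exists_lead_eq_zero (h : IsDressingChain α q) (hn : 1 ≤ n) (hcn : c ≠ 0 ∨ n ≠ 1)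
    (hl : ∀ i, HasLead c (-n) (w i) (q i)) : ∃ i, w i = 0 := by
  by_contra! hw
  have hs : w 0 + w 1 + w 2 + w 3 + w 4 + w 5 = 0 := by
    have h1 := (((((hl 0).add (hl 1)).add (hl 2)).add (hl 3)).add (hl 4)).add (hl 5)
    rw [h.sum] at h1
    exact h1.unique ((HasLead.ratX c).lower (by omega))
  obtain ⟨e, he⟩ := exists_hasLead_sum hn hl hw hs (h.chainAt c)
  rw [h.sum] at he
  by_cases hc : c = 0
  · subst hc
    have h1 : HasLead 0 1 1 RatFunc.X := by simpa using HasLead.zpow_X_sub_C 0 1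
    have := h1.le_of_ne_zero one_ne_zero he
    exact hcn.elim (fun h => h rfl) fun h => h (by omega)
  · have := (HasLead.ratX c).le_of_ne_zero hc he
    omega

theorem exists_residue (h : IsDressingChain α q) (c : ℂ) :
    ∃ k : Fin 6 → ℂ, ∀ i, HasLead c (-1) (k i) (q i) := by
  have h0 : ∃ i, q i ≠ 0 := by
    by_contra! h0
    have := h.sum
    simp only [h0, add_zero] at this
    exact RatFunc.X_ne_zero this.symm
  obtain ⟨i₀, hi₀⟩ := h0
  obtain ⟨n, m, hm, i₁, hi₁⟩ := HasLead.exists_family c q i₀ hi₀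
  by_cases hn : -1 ≤ n
  · choose k hk using fun i => (hm i).lower_le hn
    exact ⟨k, hk⟩
  exfalso
  obtain ⟨N, rfl⟩ : ∃ N, n = -N := ⟨-n, by simp⟩
  obtain ⟨i₂, hi₂⟩ := h.exists_lead_eq_zero (by omega) (Or.inr (by omega)) hm
  have hstep (i) (hi : m i = 0) : m (i + 1) = 0 := by
    rcases (h.chainAt c i).lead_rel (by omega) (hm i) (hm _) with h | h
    · simp [h, hi]
    · rw [if_neg (by omega)] at h
      simp [h, hi]
  have (k : Fin 6) : m (i₂ + k) = 0 := by
    induction k using cyclic_induction with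
    | zero => simpa using hi₂
    | step k ih => rw [← add_assoc]; exact hstep _ ih
  apply hi₁
  simpa using this (i₁ - i₂)

theorem residue_rel (h : IsDressingChain α q) (hl : ∀ i, HasLead c (-1) (w i) (q i)) (i : Fin 6) :
    w (i + 1) = -w i ∨ w (i + 1) = w i - 1 / 2 := by
  simpa using (h.chainAt c i).lead_rel le_rfl (hl i) (hl _)

theorem two_mul_residue (h : IsDressingChain α q) (hl : ∀ i, HasLead c (-1) (w i) (q i))
    (hc : c ≠ 0) (i : Fin 6) : IsInt (2 * w i) := by
  obtain ⟨i₂, hi₂⟩ := h.exists_lead_eq_zero le_rfl (Or.inl hc) hl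
  have (k : Fin 6) : IsInt (2 * w (i₂ + k)) := by
    induction k using cyclic_induction with
    | zero => exact ⟨0, by simp [hi₂]⟩
    | step k ih =>
      obtain ⟨n, hn⟩ := ih
      rw [← add_assoc]
      rcases h.residue_rel hl (i₂ + k) with h | h
      · exact ⟨-n, by rw [h]; push_cast; linear_combination -hn⟩
      · exact ⟨n - 1, by rw [h]; push_cast; linear_combination hn⟩
  simpa using this (i - i₂)

end IsDressingChain

/-! ### Uniqueness and parity of chains with given signs -/

theorem eq_zero_of_sgn_mul_eq {σ : Fin 6 → Bool} {e : Fin 6 → ℂ}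
    (hσ : (Finset.univ.filter fun i => σ i = true).card = 4)
    (h : ∀ i, sgn (σ (i + 1)) * e (i + 1) = sgn (σ i) * e i)
    (hs : e 0 + e 1 + e 2 + e 3 + e 4 + e 5 = 0) (i : Fin 6) : e i = 0 := by
  have key (k : Fin 6) : e k = sgn (σ k) * (sgn (σ 0) * e 0) := by
    induction k using cyclic_induction with
    | zero => linear_combination -e 0 * sgn_mul_self (σ 0)
    | step k ih =>
      linear_combination -e (k + 1) * sgn_mul_self (σ (k + 1)) + sgn (σ (k + 1)) * h k +
        sgn (σ (k + 1)) * sgn (σ k) * ih +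
        sgn (σ (k + 1)) * (sgn (σ 0) * e 0) * sgn_mul_self (σ k)
  have h0 : sgn (σ 0) * e 0 = 0 := by
    rw [key 1, key 2, key 3, key 4, key 5] at hs
    linear_combination hs / 2 - sgn (σ 0) * e 0 / 2 * sum_sgn σ hσ + e 0 / 2 * sgn_mul_self (σ 0)
  rw [key, h0, mul_zero]

theorem HasSigns.leadInf {σ : Fin 6 → Bool} {q : Fin 6 → RatFunc ℂ} (h : HasSigns σ q)
    (i : Fin 6) : LeadInf 1 (sgn (σ i) / 2) (q i) := by
  obtain ⟨m, hm⟩ := h.mem i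
  simpa using (hm.raise (k := 1) (by omega)).add (LeadInf.ratX.C_mul (sgn (σ i) / 2))

theorem IsDressingChain.eq_of_hasSigns {α : Fin 6 → ℂ} {σ : Fin 6 → Bool} {p q : Fin 6 → RatFunc ℂ}
    (hp : IsDressingChain α p) (hq : IsDressingChain α q) (hpσ : HasSigns σ p)
    (hqσ : HasSigns σ q) : p = q := by
  by_contra hne
  obtain ⟨i₀, hi₀⟩ := Function.ne_iff.1 hne
  obtain ⟨n, e, he, i, hi⟩ := LeadInf.exists_family (fun i => p i - q i) i₀ (sub_ne_zero.2 hi₀)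
  refine hi (eq_zero_of_sgn_mul_eq hpσ.card (fun i => ?_) ?_ i)
  · have h1 := ((((he i).add (he (i + 1))).dRat.C_mul (1 / 2))).raise (k := 1 + n) (by omega)
    have h2 := (((hpσ.leadInf (i + 1)).add (hqσ.leadInf (i + 1))).mul (he (i + 1))).sub
      (((hpσ.leadInf i).add (hqσ.leadInf i)).mul (he i))
    have h3 : RatFunc.C (1 / 2) * dRat (p i - q i + (p (i + 1) - q (i + 1))) =
        (p (i + 1) + q (i + 1)) * (p (i + 1) - q (i + 1)) - (p i + q i) * (p i - q i) := by
      have e1 := hp.chain i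
      have e2 := hq.chain i
      simp only [map_add, map_sub] at e1 e2 ⊢
      linear_combination e1 - e2
    rw [h3] at h1
    linear_combination h2.unique h1
  · have h1 := (((((he 0).add (he 1)).add (he 2)).add (he 3)).add (he 4)).add (he 5)
    rw [show p 0 - q 0 + (p 1 - q 1) + (p 2 - q 2) + (p 3 - q 3) + (p 4 - q 4) + (p 5 - q 5) = 0 by
      linear_combination hp.sum - hq.sum] at h1
    exact h1.unique (LeadInf.zero n)

theorem LeadInf.negSubst_mem_bddInf {m : ℂ} {f : RatFunc ℂ} (h : LeadInf 0 m f) :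
    negSubst f ∈ bddInf := by
  have hcomm : invSubst (negSubst f) = negSubst (invSubst f) := by
    rw [← RatFunc.num_div_denom f, substRat_div, substRat_div, map_div₀, map_div₀,
      ← aeval_algHom_apply, ← aeval_algHom_apply, ← aeval_algHom_apply, ← aeval_algHom_apply]
    simp only [substRat_X, map_neg, map_inv₀, neg_inv]
  refine ⟨m, ?_⟩
  rw [LeadInf, hcomm]
  have h' : HasLead (-0) 0 m (invSubst f) := by simpa [LeadInf] using h
  simpa using h'.negSubst

theorem IsDressingChain.neg_negSubst {α : Fin 6 → ℂ} {q : Fin 6 → RatFunc ℂ}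
    (h : IsDressingChain α q) : IsDressingChain α fun i => -negSubst (q i) where
  chain i := by
    have h1 := congrArg negSubst (h.chain i)
    simp only [map_mul, map_add, map_sub, map_pow, substRat_C] at h1
    simp only [map_add, map_neg, negSubst_dRat]
    linear_combination h1
  sum := by
    have h1 := congrArg negSubst h.sum
    simp only [map_add, substRat_X] at h1
    linear_combination -h1

theorem HasSigns.neg_negSubst {σ : Fin 6 → Bool} {q : Fin 6 → RatFunc ℂ} (h : HasSigns σ q) :
    HasSigns σ fun i => -negSubst (q i) where
  card := h.card
  mem i := by
    obtain ⟨m, hm⟩ := h.mem i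
    convert bddInf.neg_mem hm.negSubst_mem_bddInf using 1
    simp only [map_sub, map_mul, substRat_C, substRat_X]
    ring

theorem IsDressingChain.residue_neg {α : Fin 6 → ℂ} {σ : Fin 6 → Bool} {q : Fin 6 → RatFunc ℂ}
    (h : IsDressingChain α q) (hσ : HasSigns σ q) {c v w : ℂ} {i : Fin 6}
    (hv : HasLead c (-1) v (q i)) (hw : HasLead (-c) (-1) w (q i)) : w = v := by
  have h1 : -negSubst (q i) = q i :=
    congrFun (h.neg_negSubst.eq_of_hasSigns h hσ.neg_negSubst hσ) i
  have h2 := hw.negSubst.neg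
  rw [h1] at h2
  have h3 := h2.unique hv
  rw [← h3]; norm_num

theorem IsDressingChain.exists_leadInf {α : Fin 6 → ℂ} {σ : Fin 6 → Bool} {q : Fin 6 → RatFunc ℂ}
    (h : IsDressingChain α q) (hσ : HasSigns σ q) : ∃ d : Fin 6 → ℂ,
    (∀ i, LeadInf (-1) (d i) (q i - RatFunc.C (sgn (σ i) / 2) * RatFunc.X)) ∧
    ∀ i, α i = (sgn (σ i) + sgn (σ (i + 1))) / 4 + sgn (σ i) * d i -
      sgn (σ (i + 1)) * d (i + 1) := by
  choose m hm using hσ.mem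
  set r : Fin 6 → RatFunc ℂ := fun i => q i - RatFunc.C (sgn (σ i) / 2) * RatFunc.X with hr
  have hq (i) : q i = RatFunc.C (sgn (σ i) / 2) * RatFunc.X + r i := by simp [hr]
  have hsq (i) : RatFunc.C (sgn (σ i) / 2) ^ 2 = RatFunc.C (1 / 4) := by
    rw [← map_pow]; congr 1; linear_combination sgn_mul_self (σ i) / 4
  have hdiff (i) : RatFunc.C (1 / 2) * RatFunc.C (sgn (σ i) / 2 + sgn (σ (i + 1)) / 2) +
      RatFunc.C (1 / 2) * dRat (r i + r (i + 1)) = RatFunc.C (α i) +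
      ((RatFunc.C (sgn (σ (i + 1))) * (RatFunc.X * r (i + 1)) + r (i + 1) * r (i + 1)) -
        (RatFunc.C (sgn (σ i)) * (RatFunc.X * r i) + r i * r i)) := by
    have h1 := h.chain i
    have hdC (a : ℂ) : dRat (RatFunc.C a * RatFunc.X) = RatFunc.C a := by
      rw [dRat.leibniz, dRat_X, dRat_C]; simp
    have h2 (j) : RatFunc.C (sgn (σ j)) = 2 * RatFunc.C (sgn (σ j) / 2) := by
      rw [map_div₀, map_ofNat]; ring
    rw [hq i, hq (i + 1)] at h1
    simp only [map_add, hdC] at h1 ⊢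
    rw [h2, h2]
    linear_combination h1 + RatFunc.X ^ 2 * (hsq (i + 1) - hsq i)
  have hm0 (i) : m i = 0 := by
    refine eq_zero_of_sgn_mul_eq hσ.card (fun i => ?_) ?_ i
    · have h1 := ((LeadInf.const (1 / 2)).mul (LeadInf.const
        (sgn (σ i) / 2 + sgn (σ (i + 1)) / 2))).raise (k := 1 + 0) (by omega)
      have h2 := (((hm i).add (hm (i + 1))).dRat.C_mul (1 / 2)).raise (k := 1 + 0) (by omega)
      have h3 := h1.add h2
      rw [hdiff i] at h3
      have h4 (i) := ((LeadInf.ratX.mul (hm i)).C_mul (sgn (σ i))).add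
        (((hm i).mul (hm i)).raise (k := 1 + 0) (by omega))
      have h5 := ((LeadInf.const (α i)).raise (k := 1 + 0) (by omega)).add ((h4 (i + 1)).sub (h4 i))
      linear_combination h5.unique h3
    · have h1 := (((((hm 0).add (hm 1)).add (hm 2)).add (hm 3)).add (hm 4)).add (hm 5)
      refine h1.unique ?_
      convert LeadInf.zero 0 using 1
      have h2 := congrArg RatFunc.C (sum_sgn σ hσ.card)
      have h3 (j) : RatFunc.C (sgn (σ j)) = 2 * RatFunc.C (sgn (σ j) / 2) := by
        rw [map_div₀, map_ofNat]; ring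
      simp only [map_add, h3, map_ofNat] at h2
      linear_combination h.sum - RatFunc.X / 2 * h2
  have hlow (i) : ∃ d, LeadInf (-1) d (r i) := by
    have := hm i
    rw [hm0] at this
    exact this.lower
  choose d hd using hlow
  refine ⟨d, hd, fun i => ?_⟩
  have h1 := (LeadInf.const (1 / 2)).mul (LeadInf.const (sgn (σ i) / 2 + sgn (σ (i + 1)) / 2))
  have h2 := (((hd i).add (hd (i + 1))).dRat.C_mul (1 / 2)).raise (k := 0 + 0) (by omega)
  have h3 := h1.add h2
  rw [hdiff i] at h3
  have h4 (i) := ((LeadInf.ratX.mul (hd i)).C_mul (sgn (σ i))).add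
    (((hd i).mul (hd i)).raise (k := 1 + -1) (by omega))
  have h5 := (LeadInf.const (α i)).add ((h4 (i + 1)).sub (h4 i))
  linear_combination h5.unique h3

/-! ### Residues of odd functions with simple poles -/

theorem LeadInf.algebraMap_polynomial (p : ℂ[X]) :
    LeadInf p.natDegree p.leadingCoeff (algebraMap ℂ[X] (RatFunc ℂ) p) := by
  have hpow (k : ℕ) : LeadInf k 1 (RatFunc.X ^ k) := by
    induction k with
    | zero => simpa using LeadInf.const 1
    | succ k ih => simpa [pow_succ] using ih.mul LeadInf.ratX
  have h : ∀ k ∈ Finset.range (p.natDegree + 1), LeadInf p.natDegree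
      (if k = p.natDegree then p.leadingCoeff else 0) (RatFunc.C (p.coeff k) * RatFunc.X ^ k) := by
    intro k hk
    have h1 := (hpow k).C_mul (p.coeff k)
    split_ifs with hkp
    · subst hkp; simpa using h1
    · exact h1.raise (by have := Finset.mem_range.1 hk; omega)
  have h2 := LeadInf.sum h
  rw [Finset.sum_ite_eq', if_pos (Finset.self_mem_range_succ _)] at h2
  convert h2 using 1
  conv_lhs => rw [p.as_sum_range_C_mul_X_pow]
  simp

theorem LeadInf.eq_zero_of_definedAt {d : ℂ} {f : RatFunc ℂ} (h : LeadInf (-1) d f)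
    (hf : ∀ c, DefinedAt f c) : d = 0 := by
  have hdeg : f.denom.degree = 0 := by
    by_contra h0
    obtain ⟨c, hc⟩ := Complex.exists_root (f := f.denom) (by
      have := f.denom_ne_zero
      rw [← natDegree_pos_iff_degree_pos]
      rw [degree_eq_natDegree this] at h0
      exact Nat.pos_of_ne_zero (by exact_mod_cast h0))
    exact hf c hc
  have hone : f.denom = 1 := f.monic_denom.degree_le_zero_iff_eq_one.1 hdeg.le
  have hfp : f = algebraMap ℂ[X] (RatFunc ℂ) f.num := by
    conv_lhs => rw [← RatFunc.num_div_denom f, hone]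
    simp
  have h1 := LeadInf.algebraMap_polynomial f.num
  rw [← hfp] at h1
  have h2 := h1.unique (h.raise (by omega))
  rw [leadingCoeff_eq_zero] at h2
  rw [h2, map_zero] at hfp
  rw [hfp] at h
  exact h.unique (LeadInf.zero _)

theorem IsInt.add {a b : ℂ} : IsInt a → IsInt b → IsInt (a + b) := by
  rintro ⟨m, rfl⟩ ⟨n, rfl⟩; exact ⟨m + n, by push_cast; rfl⟩

theorem IsInt.neg {a : ℂ} : IsInt a → IsInt (-a) := by
  rintro ⟨m, rfl⟩; exact ⟨-m, by push_cast; rfl⟩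

theorem IsInt.sub {a b : ℂ} (ha : IsInt a) (hb : IsInt b) : IsInt (a - b) := by
  rw [sub_eq_add_neg]; exact ha.add hb.neg

theorem isInt_intCast (n : ℤ) : IsInt n := ⟨n, rfl⟩

theorem isInt_sum_sub_of_symmetric {S : Finset ℂ} {k : ℂ → ℂ} (hS : ∀ c, c ∈ S ↔ k c ≠ 0)
    (hk : ∀ c, k (-c) = k c) (h2 : ∀ c ≠ 0, IsInt (2 * k c)) : IsInt (∑ c ∈ S, k c - k 0) := by
  have h1 : ∑ c ∈ S, k c - k 0 = ∑ c ∈ S.erase 0, k c := by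
    by_cases h0 : (0 : ℂ) ∈ S
    · rw [← Finset.add_sum_erase _ _ h0, add_sub_cancel_left]
    · rw [Finset.erase_eq_of_notMem h0, not_not.1 fun h => h0 ((hS 0).2 h), sub_zero]
  have h3 : ∑ c ∈ S.erase 0, (QuotientAddGroup.mk (k c) : ℂ ⧸ (Int.castAddHom ℂ).range) = 0 := by
    refine Finset.sum_involution (fun c _ => -c) (fun c hc => ?_) (fun c hc _ => ?_)
      (fun c hc => ?_) (fun c _ => neg_neg c)
    · obtain ⟨n, hn⟩ := h2 c (Finset.ne_of_mem_erase hc)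
      rw [hk, ← QuotientAddGroup.mk_add, QuotientAddGroup.eq_zero_iff, ← two_mul, hn]
      exact ⟨n, rfl⟩
    · exact fun h => Finset.ne_of_mem_erase hc (self_eq_neg.1 h.symm)
    · simpa [hS, hk] using hc
  rw [h1]
  rw [← QuotientAddGroup.mk_sum, QuotientAddGroup.eq_zero_iff] at h3
  obtain ⟨n, hn⟩ := h3
  exact ⟨n, hn.symm⟩

theorem isInt_leadInf_sub_residue {f : RatFunc ℂ} {a d : ℂ} {k : ℂ → ℂ}
    (hd : LeadInf (-1) d (f - RatFunc.C a * RatFunc.X))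
    (hl : ∀ c, HasLead c (-1) (k c) f) (hk : ∀ c, k (-c) = k c)
    (h2 : ∀ c ≠ 0, IsInt (2 * k c)) : IsInt (d - k 0) := by
  set S : Finset ℂ := f.denom.roots.toFinset.filter fun c => k c ≠ 0 with hSdef
  have hS (c) : c ∈ S ↔ k c ≠ 0 := by
    rw [hSdef, Finset.mem_filter, and_iff_right_iff_imp, Multiset.mem_toFinset,
      mem_roots f.denom_ne_zero]
    intro hc
    by_contra hroot
    exact hc ((hl c).unique ((HasLead.of_definedAt hroot).lower (by omega)))
  have hR : LeadInf (-1) (∑ c ∈ S, k c)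
      (∑ c ∈ S, RatFunc.C (k c) * (RatFunc.X - RatFunc.C c)⁻¹) := by
    refine LeadInf.sum fun c _ => ?_
    have h1 := LeadInf.ratX.sub ((LeadInf.const c).raise (k := 1) (by omega))
    simpa using (h1.inv (by simp)).C_mul (k c)
  have hdef (c) : DefinedAt (f - RatFunc.C a * RatFunc.X -
      ∑ c ∈ S, RatFunc.C (k c) * (RatFunc.X - RatFunc.C c)⁻¹) c := by
    have h1 : ∀ c' ∈ S, HasLead c (-1) (if c' = c then k c else 0)
        (RatFunc.C (k c') * (RatFunc.X - RatFunc.C c')⁻¹) := by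
      intro c' _
      split_ifs with hc
      · subst hc
        simpa using (HasLead.zpow_X_sub_C c' (-1)).C_mul (k c')
      · have := ((HasLead.ratX c).sub (HasLead.const c c')).inv (sub_ne_zero.2 (Ne.symm hc))
        exact (this.C_mul (k c')).lower (by omega)
    have h2 := ((hl c).sub (((HasLead.ratX c).C_mul a).lower (by omega))).sub (HasLead.sum h1)
    have h3 : k c - 0 - (∑ c' ∈ S, if c' = c then k c else 0) = 0 := by
      rw [Finset.sum_ite_eq']
      split_ifs with hc
      · simp
      · simpa [hS] using hc
    rw [h3] at h2
    obtain ⟨e, he⟩ := h2.raise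
    exact HasLead.definedAt he
  have h0 := (hd.sub hR).eq_zero_of_definedAt hdef
  rw [sub_eq_zero.1 h0]
  exact isInt_sum_sub_of_symmetric hS hk h2

theorem IsDressingChain.exists_residues {α : Fin 6 → ℂ} {σ : Fin 6 → Bool} {q : Fin 6 → RatFunc ℂ}
    (h : IsDressingChain α q) (hσ : HasSigns σ q) : ∃ k d : Fin 6 → ℂ,
    (∀ i, k (i + 1) = -k i ∨ k (i + 1) = k i - 1 / 2) ∧ (∀ i, IsInt (d i - k i)) ∧
    ∀ i, α i = (sgn (σ i) + sgn (σ (i + 1))) / 4 + sgn (σ i) * d i -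
      sgn (σ (i + 1)) * d (i + 1) := by
  obtain ⟨d, hd, hα⟩ := h.exists_leadInf hσ
  choose k hk using h.exists_residue
  exact ⟨k 0, d, h.residue_rel (hk 0), fun i => isInt_leadInf_sub_residue (hd i) (fun c => hk c i)
    (fun c => h.residue_neg hσ (hk c i) (hk (-c) i))
    fun c hc => h.two_mul_residue (hk c) hc i, hα⟩

/-! ### Integrality conditions on the parameters -/

/-- The integrality conditions on `α` characterising rational solutions of Type A. -/
def ParamCond (α : Fin 6 → ℂ) : Prop :=
  (∃ i : Fin 6, IsInt (α (i + 2)) ∧ IsInt (α (i + 3)) ∧ IsInt (α (i + 4)) ∧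
    IsInt (α (i + 5))) ∨
  (∃ i : Fin 6, IsInt (α (i + 1)) ∧ IsInt (α (i + 2)) ∧ IsInt (α (i + 4)) ∧
    IsInt (α (i + 5))) ∨
  (∃ i : Fin 6, IsInt (α (i + 3)) ∧ IsInt (α (i + 5)) ∧ IsInt (α i + α (i + 4)) ∧
    IsInt (α i - α (i + 2))) ∨
  (∃ i : Fin 6, IsInt (α (i + 3) + α (i + 4)) ∧ IsInt (α (i + 4) + α (i + 5)) ∧
    IsInt (α i + α (i + 1)) ∧ IsInt (α i - α (i + 4))) ∨
  (∃ i : Fin 6, IsInt (α i + α (i + 1)) ∧ IsInt (α i + α (i + 5)) ∧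
    IsInt (α (i + 2) + α (i + 3)) ∧ IsInt (α (i + 3) + α (i + 4)) ∧ IsInt (α i + α (i + 3)))

/-- The integer sign `±1` encoded by a Boolean. -/
def zsgn (b : Bool) : ℤ := if b then 1 else -1

theorem sgn_eq_zsgn (b : Bool) : sgn b = zsgn b := by cases b <;> simp [zsgn]

theorem sgn_beq (b c : Bool) : sgn (b == c) = sgn b * sgn c := by cases b <;> cases c <;> simp

theorem IsInt.sgn_mul {z : ℂ} (h : IsInt z) (b : Bool) : IsInt (sgn b * z) := by
  cases b
  · simpa using h.neg
  · simpa using h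

theorem isInt_sgn_half_sub (b c : Bool) : IsInt ((sgn b - sgn c) / 2) := by
  cases b <;> cases c
  exacts [⟨0, by simp⟩, ⟨-1, by norm_num⟩, ⟨1, by norm_num⟩, ⟨0, by simp⟩]

theorem odd_card_patterns (e : Fin 6 → Bool)
    (h : Odd (Finset.univ.filter fun i => e i = true).card) :
    (∃ i : Fin 6, e (i + 2) = e (i + 3) ∧ e (i + 3) = e (i + 4) ∧ e (i + 4) = e (i + 5) ∧
      e (i + 5) = e i) ∨
    (∃ i : Fin 6, e (i + 1) = e (i + 2) ∧ e (i + 2) = e (i + 3) ∧ e (i + 4) = e (i + 5) ∧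
      e (i + 5) = e i) ∨
    (∃ i : Fin 6, e (i + 3) = e (i + 4) ∧ e (i + 5) = e i ∧ e i = e (i + 2) ∧
      e (i + 1) = e (i + 3) ∧ e i = !e (i + 1)) ∨
    (e 0 = e 2 ∧ e 2 = e 4 ∧ e 1 = e 3 ∧ e 3 = e 5) := by
  revert e; decide

theorem paramCond_of_pattern {α : Fin 6 → ℂ} {e : Fin 6 → Bool} {a : ℂ}
    (he : Odd (Finset.univ.filter fun i => e i = true).card)
    (h : ∀ i, IsInt (α i - (sgn (e i) - sgn (e (i + 1))) * a)) : ParamCond α := by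
  have h' (i j k : Fin 6) (hj : i + j + 1 = i + k) :
      IsInt (α (i + j) - (sgn (e (i + j)) - sgn (e (i + k))) * a) := hj ▸ h (i + j)
  have hz (i : Fin 6) := h' i 0 1 (by simp)
  have ho (i : Fin 6) := h' i 1 2 (by simp [add_assoc])
  have ht (i : Fin 6) := h' i 2 3 (by simp [add_assoc])
  have hu (i : Fin 6) := h' i 3 4 (by simp [add_assoc])
  have hv (i : Fin 6) := h' i 4 5 (by simp [add_assoc])
  have hw (i : Fin 6) := h' i 5 0 (by simp [add_assoc])
  simp only [add_zero] at hz hw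
  rcases odd_card_patterns e he with ⟨i, h1, h2, h3, h4⟩ | ⟨i, h1, h2, h3, h4⟩ |
    ⟨i, h1, h2, h3, h4, h5⟩ | ⟨h1, h2, h3, h4⟩
  · refine Or.inl ⟨i, ?_, ?_, ?_, ?_⟩
    · simpa [h1] using ht i
    · simpa [h2] using hu i
    · simpa [h3] using hv i
    · simpa [h4] using hw i
  · refine Or.inr (Or.inl ⟨i, ?_, ?_, ?_, ?_⟩)
    · simpa [h1] using ho i
    · simpa [h2] using ht i
    · simpa [h3] using hv i
    · simpa [h4] using hw i
  · refine Or.inr (Or.inr (Or.inl ⟨i, ?_, ?_, ?_, ?_⟩))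
    · simpa [h1] using hu i
    · simpa [h2] using hw i
    · convert (hz i).add (hv i) using 1
      rw [← h1, h2, h4]; ring
    · convert (hz i).sub (ht i) using 1
      rw [← h3, h4]; ring
  · refine Or.inr (Or.inr (Or.inr (Or.inl ⟨0, ?_, ?_, ?_, ?_⟩)))
    · convert (hu 0).add (hv 0) using 1
      simp only [zero_add, h4]; ring
    · convert (hv 0).add (hw 0) using 1
      simp only [zero_add, h1, h2]; ring
    · convert (hz 0).add (ho 0) using 1
      simp only [zero_add, h1, h2]; ring
    · convert (hz 0).sub (hv 0) using 1
      simp only [zero_add, h1, h2, h3, h4]; ring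

theorem isInt_shifted_residue {x y : ℂ} {b : Bool} (n : ℤ)
    (h : y = sgn b * x - (1 + sgn b) / 4) :
    IsInt (y - 1 / 4 - (n + 1) / 2 - sgn b * (x - 1 / 4 - n / 2)) := by
  subst h
  cases b
  · exact ⟨-1 - n, by push_cast; simp only [sgn_false]; ring⟩
  · exact ⟨-1, by push_cast; simp only [sgn_true]; ring⟩

theorem IsInt.sub_sgn_mul_trans {x y z : ℂ} {b c : Bool} (h : IsInt (x - sgn b * z))
    (h' : IsInt (y - sgn c * x)) : IsInt (y - sgn (b == c) * z) := by
  convert h'.add (h.sgn_mul c) using 1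
  rw [sgn_beq]; ring

/-- The partial products of a sequence of six signs, starting with the empty product. -/
def partialSigns (φ : Fin 6 → Bool) : Fin 6 → Bool :=
  ![true, φ 0, φ 0 == φ 1, (φ 0 == φ 1) == φ 2, ((φ 0 == φ 1) == φ 2) == φ 3,
    (((φ 0 == φ 1) == φ 2) == φ 3) == φ 4]

theorem odd_card_partialSigns (φ : Fin 6 → Bool)
    (hφ : (partialSigns φ 5 == φ 5) = true)
    (h : ∑ i, (if φ i then zsgn (partialSigns φ i) else 0) = 0) :
    (Finset.univ.filter fun i => partialSigns φ i = true).card = 3 := by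
  revert φ; decide

theorem odd_card_beq (σ τ : Fin 6 → Bool)
    (hσ : (Finset.univ.filter fun i => σ i = true).card = 4)
    (hτ : (Finset.univ.filter fun i => τ i = true).card = 3) :
    Odd (Finset.univ.filter fun i => (σ i == τ i) = true).card := by
  revert σ τ; decide +kernel

theorem sgn_beq_mul_residue {x y : ℂ} {b : Bool} (c : Bool)
    (h : y = sgn b * x - (1 + sgn b) / 4) :
    sgn (c == b) * y = sgn c * x - sgn c * (1 + sgn b) / 4 := by
  rw [h, sgn_beq]
  linear_combination (sgn c * x - sgn c / 4) * sgn_mul_self b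

theorem paramCond_of_residues {α k d : Fin 6 → ℂ} {σ : Fin 6 → Bool}
    (hσ : (Finset.univ.filter fun i => σ i = true).card = 4)
    (hk : ∀ i, k (i + 1) = -k i ∨ k (i + 1) = k i - 1 / 2) (hd : ∀ i, IsInt (d i - k i))
    (hα : ∀ i, α i = (sgn (σ i) + sgn (σ (i + 1))) / 4 + sgn (σ i) * d i -
      sgn (σ (i + 1)) * d (i + 1)) : ParamCond α := by
  have hφ (i) : ∃ b : Bool, k (i + 1) = sgn b * k i - (1 + sgn b) / 4 := by
    rcases hk i with h | h
    · exact ⟨false, by rw [h]; simp⟩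
    · exact ⟨true, by rw [h]; norm_num⟩
  choose φ hφ using hφ
  have p0 := hφ 0
  have p1 := hφ 1
  have p2 := hφ 2
  have p3 := hφ 3
  have p4 := hφ 4
  have p5 := hφ 5
  simp only [Fin.reduceAdd, zero_add] at p0 p1 p2 p3 p4 p5
  set a : ℂ := k 0 - 1 / 4 with ha
  have a1 : IsInt (k 1 - 3 / 4 - sgn (φ 0) * a) := by
    convert isInt_shifted_residue 0 p0 using 1; push_cast; ring
  have a2 := a1.sub_sgn_mul_trans (y := k 2 - 5 / 4) (c := φ 1) (by
    convert isInt_shifted_residue 1 p1 using 1; push_cast; ring)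
  have a3 := a2.sub_sgn_mul_trans (y := k 3 - 7 / 4) (c := φ 2) (by
    convert isInt_shifted_residue 2 p2 using 1; push_cast; ring)
  have a4 := a3.sub_sgn_mul_trans (y := k 4 - 9 / 4) (c := φ 3) (by
    convert isInt_shifted_residue 3 p3 using 1; push_cast; ring)
  have a5 := a4.sub_sgn_mul_trans (y := k 5 - 11 / 4) (c := φ 4) (by
    convert isInt_shifted_residue 4 p4 using 1; push_cast; ring)
  have a6 := a5.sub_sgn_mul_trans (y := k 0 - 13 / 4) (c := φ 5) (by
    convert isInt_shifted_residue 5 p5 using 1; push_cast; ring)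
  set τ := partialSigns φ with hτ
  let c : Fin 6 → ℂ := ![1 / 4, 3 / 4, 5 / 4, 7 / 4, 9 / 4, 11 / 4]
  have hA (i) : IsInt (k i - c i - sgn (τ i) * a) := by
    fin_cases i
    exacts [⟨0, by simp [c, hτ, partialSigns, ha]⟩, a1, a2, a3, a4, a5]
  have hrem (i) : IsInt ((sgn (σ i) + sgn (σ (i + 1))) / 4 + sgn (σ i) * c i -
      sgn (σ (i + 1)) * c (i + 1)) := by
    have hs (n : ℤ) (i j : Fin 6) : IsInt (n * ((sgn (σ i) - sgn (σ j)) / 2)) := by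
      obtain ⟨m, hm⟩ := isInt_sgn_half_sub (σ i) (σ j)
      exact ⟨n * m, by rw [hm]; push_cast; rfl⟩
    fin_cases i
    · convert hs 1 0 1 using 1; simp [c]; ring
    · convert hs 2 1 2 using 1; simp [c]; ring
    · convert hs 3 2 3 using 1; simp [c]; ring
    · convert hs 4 3 4 using 1; simp [c]; ring
    · convert hs 5 4 5 using 1; simp [c]; ring
    · convert (isInt_intCast 3).sgn_mul (σ 5) using 1; simp [c]; ring
  have hpat (i) : IsInt (α i - (sgn (σ i == τ i) - sgn (σ (i + 1) == τ (i + 1))) * a) := by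
    convert ((((hd i).add (hA i)).sgn_mul (σ i)).sub
      (((hd (i + 1)).add (hA (i + 1))).sgn_mul (σ (i + 1)))).add (hrem i) using 1
    rw [hα i, sgn_beq, sgn_beq]
    ring
  by_cases hcl : (τ 5 == φ 5) = true
  · refine paramCond_of_pattern (odd_card_beq σ τ hσ (odd_card_partialSigns φ hcl ?_)) hpat
    have q0 := sgn_beq_mul_residue true p0
    have q1 := sgn_beq_mul_residue (τ 1) p1
    have q2 := sgn_beq_mul_residue (τ 2) p2
    have q3 := sgn_beq_mul_residue (τ 3) p3
    have q4 := sgn_beq_mul_residue (τ 4) p4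
    have q5 := sgn_beq_mul_residue (τ 5) p5
    rw [hcl] at q5
    have hz (i) : ((if φ i then zsgn (partialSigns φ i) else 0 : ℤ) : ℂ) =
        sgn (τ i) * (1 + sgn (φ i)) / 2 := by
      rw [← hτ]
      cases φ i
      · simp
      · rw [if_pos rfl, sgn_true, sgn_eq_zsgn]; ring
    rw [← Int.cast_inj (α := ℂ), Int.cast_sum, Finset.sum_congr rfl fun i _ => hz i,
      Fin.sum_univ_six, Int.cast_zero]
    rw [show (true == φ 0) = τ 1 by simp [hτ, partialSigns]] at q0
    change sgn (τ 2) * _ = _ at q1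
    change sgn (τ 3) * _ = _ at q2
    change sgn (τ 4) * _ = _ at q3
    change sgn (τ 5) * _ = _ at q4
    change _ = sgn true * _ - sgn true * _ / _ at q0
    change sgn true * _ = _ at q5
    change sgn true * _ / _ + _ + _ + _ + _ + _ = _
    linear_combination 2 * (q0 + q1 + q2 + q3 + q4 + q5)
  · have h2a : IsInt (2 * a) := by
      change IsInt (k 0 - 13 / 4 - sgn (τ 5 == φ 5) * a) at a6
      rw [Bool.not_eq_true] at hcl
      rw [hcl, sgn_false] at a6
      convert a6.add (isInt_intCast 3) using 1
      rw [ha]; push_cast; ring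
    have hint (i) : IsInt (α i) := by
      obtain ⟨m, hm⟩ := isInt_sgn_half_sub (σ i == τ i) (σ (i + 1) == τ (i + 1))
      obtain ⟨n, hn⟩ := h2a
      convert (hpat i).add (isInt_intCast (m * n)) using 1
      push_cast
      rw [← hm, ← hn]; ring
    exact Or.inl ⟨0, hint _, hint _, hint _, hint _⟩

theorem IsDressingChain.paramCond {α : Fin 6 → ℂ} {σ : Fin 6 → Bool} {q : Fin 6 → RatFunc ℂ}
    (h : IsDressingChain α q) (hσ : HasSigns σ q) : ParamCond α := by
  obtain ⟨k, d, hk, hd, hα⟩ := h.exists_residues hσ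
  exact paramCond_of_residues hσ.card hk hd hα

/-! ### Bäcklund transformations -/

theorem HasSigns.of_leadInf {σ : Fin 6 → Bool} {q : Fin 6 → RatFunc ℂ}
    (hσ : (Finset.univ.filter fun i => σ i = true).card = 4)
    (h : ∀ i, LeadInf 1 (sgn (σ i) / 2) (q i)) : HasSigns σ q where
  card := hσ
  mem i := by
    have h1 := (h i).sub (LeadInf.ratX.C_mul (sgn (σ i) / 2))
    rw [mul_one, sub_self] at h1
    exact h1.lower

/-- The parameters attached to a point of the weight lattice of the extended affine Weyl group. -/
def paramOf (ε : Fin 6 → ℂ) (i : Fin 6) : ℂ := ε i - ε (i + 1) + if i = 5 then 1 else 0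

/-- The dressing chain with parameters `paramOf ε` has a rational solution of Type A. -/
def Solvable (ε : Fin 6 → ℂ) : Prop :=
  ∃ σ q, IsDressingChain (paramOf ε) q ∧ HasSigns σ q

theorem Solvable.add_const {ε : Fin 6 → ℂ} (h : Solvable ε) (c : ℂ) :
    Solvable fun i => ε i + c := by
  have h1 : paramOf (fun i => ε i + c) = paramOf ε := by
    funext i; simp [paramOf]
  rwa [Solvable, h1]

/-- The generator of infinite order of the extended affine Weyl group. -/
def rotParam (ε : Fin 6 → ℂ) (i : Fin 6) : ℂ := ε (i + 1) - if i = 5 then 1 else 0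

theorem paramOf_rotParam (ε : Fin 6 → ℂ) (i : Fin 6) :
    paramOf (rotParam ε) i = paramOf ε (i + 1) := by
  fin_cases i <;> simp [paramOf, rotParam] <;> ring

theorem Solvable.rot {ε : Fin 6 → ℂ} (h : Solvable ε) : Solvable (rotParam ε) := by
  obtain ⟨σ, q, hq, hσ⟩ := h
  refine ⟨fun i => σ (i + 1), fun i => q (i + 1), ⟨fun i => ?_, ?_⟩, ?_, fun i => hσ.mem (i + 1)⟩
  · rw [paramOf_rotParam]; exact hq.chain (i + 1)
  · rw [← hq.sum]; simp only [Fin.reduceAdd, zero_add]; ring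
  · rw [← hσ.card, Finset.card_filter, Finset.card_filter]
    exact Equiv.sum_comp (Equiv.addRight 1) fun j => if σ j = true then 1 else 0

theorem solvable_rotParam {ε : Fin 6 → ℂ} : Solvable (rotParam ε) ↔ Solvable ε := by
  refine ⟨fun h => ?_, Solvable.rot⟩
  convert h.rot.rot.rot.rot.rot.add_const 1 using 1
  funext i
  fin_cases i <;> simp [rotParam]

theorem Solvable.swap_zero_one {ε : Fin 6 → ℂ} (h : Solvable ε) :
    Solvable (ε ∘ Equiv.swap 0 1) := by
  obtain ⟨σ, q, hq, hσ⟩ := h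
  set a := ε 0 - ε 1 with ha
  by_cases ha0 : a = 0
  · have h1 : ε ∘ Equiv.swap 0 1 = ε := by
      have h01 := sub_eq_zero.1 ha0
      funext i
      fin_cases i
      exacts [h01.symm, h01, rfl, rfl, rfl, rfl]
    rw [h1]; exact ⟨σ, q, hq, hσ⟩
  set f := q 0 + q 1 with hf
  have hchain0 : RatFunc.C (1 / 2) * dRat f = RatFunc.C a + q 1 ^ 2 - q 0 ^ 2 := by
    have h1 : paramOf ε 0 = a := by simp [paramOf, ha]
    rw [← h1]; exact hq.chain 0
  have hf0 : f ≠ 0 := by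
    intro h0
    rw [h0, map_zero, mul_zero] at hchain0
    have h1 : RatFunc.C a = 0 := by linear_combination -hchain0 + (q 0 - q 1) * h0
    exact ha0 (by simpa using h1)
  set g := RatFunc.C a * f⁻¹ with hg
  have hgf : g * f = RatFunc.C a := by rw [hg, mul_assoc, inv_mul_cancel₀ hf0, mul_one]
  have hdg : RatFunc.C (1 / 2) * dRat g = -g ^ 2 - g * (q 1 - q 0) := by
    have h1 : dRat g * f + g * dRat f = 0 := by
      have := congrArg dRat hgf
      rw [dRat.leibniz, dRat_C] at this
      simp only [smul_eq_mul] at this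
      linear_combination this
    apply mul_right_cancel₀ hf0
    linear_combination RatFunc.C (1 / 2) * h1 - g * hchain0 + g * hgf + g * (q 1 - q 0) * hf
  have hlead : LeadInf 1 ((sgn (σ 0) - sgn (σ 1)) / 2) g := by
    by_cases h01 : σ 0 = σ 1
    · rw [h01, sub_self, zero_div]
      have h1 := (hσ.leadInf 0).add (hσ.leadInf 1)
      rw [← hf, h01, add_halves] at h1
      exact ((h1.inv (by cases σ 1 <;> simp)).C_mul a).raise (by omega)
    · have hs : sgn (σ 0) = -sgn (σ 1) := by
        revert h01; cases σ 0 <;> cases σ 1 <;> simp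
      obtain ⟨m, hm⟩ : f ∈ bddInf := by
        convert bddInf.add_mem (hσ.mem 0) (hσ.mem 1) using 1
        rw [hs, neg_div, map_neg]; ring
      have hs0 : sgn (σ 1) ≠ 0 := by cases σ 1 <;> simp
      have h1 := ((hm.dRat.C_mul (1 / 2)).raise (k := 0) (by omega)).sub (LeadInf.const a)
      have h2 := (hσ.leadInf 1).sub (hσ.leadInf 0)
      rw [hs, show sgn (σ 1) / 2 - -sgn (σ 1) / 2 = sgn (σ 1) by ring] at h2
      have h3 := (h2.mul (h1.inv (by simpa using ha0))).C_mul a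
      have hne : q 1 - q 0 ≠ 0 := fun h0 => hs0 (h2.unique (h0 ▸ LeadInf.zero 1))
      rw [show RatFunc.C (1 / 2) * dRat f - RatFunc.C a = (q 1 - q 0) * f by
        linear_combination hchain0 - (q 1 - q 0) * hf, mul_inv, mul_inv_cancel_left₀ hne] at h3
      convert h3 using 1
      · simp
      · rw [hs]; field_simp; ring
  have hα : paramOf (ε ∘ Equiv.swap 0 1) = ![-a, paramOf ε 1 + a, paramOf ε 2, paramOf ε 3,
      paramOf ε 4, paramOf ε 5 + a] := by
    funext i
    fin_cases i
    · simp [paramOf, ha]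
    · simp [paramOf, ha, Equiv.swap_apply_def]
    · simp [paramOf, Equiv.swap_apply_def]
    · simp [paramOf, Equiv.swap_apply_def]
    · simp [paramOf, Equiv.swap_apply_def]
    · simp [paramOf, ha, Equiv.swap_apply_def]; ring
  have c1 := hq.chain 1
  have c5 := hq.chain 5
  simp only [Fin.reduceAdd, map_add] at c1 c5
  refine ⟨σ ∘ Equiv.swap 0 1, ![q 0 - g, q 1 + g, q 2, q 3, q 4, q 5], ⟨fun i => ?_, ?_⟩,
    HasSigns.of_leadInf ?_ fun i => ?_⟩
  · rw [hα]
    fin_cases i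
    · change RatFunc.C (1 / 2) * dRat (q 0 - g + (q 1 + g)) =
        RatFunc.C (-a) + (q 1 + g) ^ 2 - (q 0 - g) ^ 2
      rw [sub_add_add_cancel, ← hf, map_neg]
      linear_combination hchain0 - 2 * hgf + 2 * g * hf
    · change RatFunc.C (1 / 2) * dRat (q 1 + g + q 2) =
        RatFunc.C (paramOf ε 1 + a) + q 2 ^ 2 - (q 1 + g) ^ 2
      simp only [map_add]
      linear_combination c1 + hdg + hgf - g * hf
    · exact hq.chain 2
    · exact hq.chain 3
    · exact hq.chain 4
    · change RatFunc.C (1 / 2) * dRat (q 5 + (q 0 - g)) =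
        RatFunc.C (paramOf ε 5 + a) + (q 0 - g) ^ 2 - q 5 ^ 2
      simp only [map_add, map_sub]
      linear_combination c5 - hdg + hgf - g * hf
  · change q 0 - g + (q 1 + g) + q 2 + q 3 + q 4 + q 5 = _
    rw [← hq.sum]; ring
  · rw [← hσ.card, Finset.card_filter, Finset.card_filter]
    exact Equiv.sum_comp (Equiv.swap 0 1) fun j => if σ j = true then 1 else 0
  · have hl := hσ.leadInf
    fin_cases i
    · convert (hl 0).sub hlead using 1
      · simp; ring
      · rfl
    · convert (hl 1).add hlead using 1
      · simp; ring
      · rfl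
    · exact hl 2
    · exact hl 3
    · exact hl 4
    · exact hl 5

theorem solvable_comp_swap (j : Fin 5) {ε : Fin 6 → ℂ} :
    Solvable (ε ∘ Equiv.swap j.castSucc j.succ) ↔ Solvable ε := by
  have h0 (ε : Fin 6 → ℂ) : Solvable (ε ∘ Equiv.swap 0 1) ↔ Solvable ε := by
    refine ⟨fun h => ?_, Solvable.swap_zero_one⟩
    convert h.swap_zero_one using 1
    funext i; simp
  have hstep (j : Fin 6) (hj : j + 1 ≠ 5 ∧ j ≠ 5)
      (h : ∀ ε : Fin 6 → ℂ, Solvable (ε ∘ Equiv.swap j (j + 1)) ↔ Solvable ε) (ε : Fin 6 → ℂ) :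
      Solvable (ε ∘ Equiv.swap (j + 1) (j + 1 + 1)) ↔ Solvable ε := by
    rw [← solvable_rotParam (ε := ε), ← h (rotParam ε), ← solvable_rotParam]
    have heq : rotParam (ε ∘ Equiv.swap (j + 1) (j + 1 + 1)) =
        rotParam ε ∘ Equiv.swap j (j + 1) := by
      funext i
      have h5 : (Equiv.swap j (j + 1) i = 5) ↔ i = 5 := by
        clear h; revert i j; decide
      have h6 : Equiv.swap (j + 1) (j + 1 + 1) (i + 1) = Equiv.swap j (j + 1) i + 1 := by
        clear h; revert i j; decide
      simp only [rotParam, Function.comp_apply, h5, h6]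
    rw [heq]
  have h1 := hstep 0 (by decide) h0
  have h2 := hstep 1 (by decide) h1
  have h3 := hstep 2 (by decide) h2
  have h4 := hstep 3 (by decide) h3
  fin_cases j
  exacts [h0 ε, h1 ε, h2 ε, h3 ε, h4 ε]

theorem solvable_comp_perm (π : Equiv.Perm (Fin 6)) (ε : Fin 6 → ℂ) :
    Solvable (ε ∘ π) ↔ Solvable ε := by
  have hπ : π ∈ Submonoid.closure (Set.range fun i : Fin 5 => Equiv.swap i.castSucc i.succ) := by
    rw [Equiv.Perm.mclosure_swap_castSucc_succ]; exact Submonoid.mem_top π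
  induction hπ using Submonoid.closure_induction generalizing ε with
  | mem π h =>
    obtain ⟨j, rfl⟩ := h
    exact solvable_comp_swap j
  | one => rfl
  | mul π ρ _ _ hπ hρ =>
    rw [Equiv.Perm.coe_mul, ← Function.comp_assoc]
    exact (hρ _).trans (hπ _)

theorem solvable_add_int (n : Fin 6 → ℤ) (ε : Fin 6 → ℂ) :
    Solvable (fun i => ε i + n i) ↔ Solvable ε := by
  have h0 (ε : Fin 6 → ℂ) : Solvable (fun i => ε i + (Pi.single 0 1 : Fin 6 → ℤ) i) ↔
      Solvable ε := by
    rw [← solvable_rotParam, ← solvable_comp_perm (Equiv.addRight 1) ε]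
    have : rotParam (fun i => ε i + (Pi.single 0 1 : Fin 6 → ℤ) i) =
        ε ∘ Equiv.addRight 1 := by
      funext i
      fin_cases i <;> simp [rotParam]
    rw [this]
  have h1 (j : Fin 6) (ε : Fin 6 → ℂ) :
      Solvable (fun i => ε i + (Pi.single j 1 : Fin 6 → ℤ) i) ↔ Solvable ε := by
    rw [← solvable_comp_perm (Equiv.addRight j), ← solvable_comp_perm (Equiv.addRight j) ε]
    have : (fun i => ε i + (Pi.single j 1 : Fin 6 → ℤ) i) ∘ Equiv.addRight j =
        fun i => (ε ∘ Equiv.addRight j) i + (Pi.single 0 1 : Fin 6 → ℤ) i := by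
      funext i
      simp [Pi.single_apply]
    rw [this]
    exact h0 _
  have h2 (j : Fin 6) (m : ℤ) (ε : Fin 6 → ℂ) :
      Solvable (fun i => ε i + (Pi.single j m : Fin 6 → ℤ) i) ↔ Solvable ε := by
    have hs (m : ℤ) : Solvable (fun i => ε i + (Pi.single j (m + 1) : Fin 6 → ℤ) i) ↔
        Solvable (fun i => ε i + (Pi.single j m : Fin 6 → ℤ) i) := by
      rw [← h1 j fun i => ε i + (Pi.single j m : Fin 6 → ℤ) i]
      simp only [Pi.single_add, Pi.add_apply, Int.cast_add, add_assoc]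
    induction m using Int.induction_on with
    | zero => simp
    | succ m ih => exact (hs m).trans ih
    | pred m ih =>
      have h := hs (-m - 1)
      rw [sub_add_cancel] at h
      exact h.symm.trans ih
  have h3 (s : Finset (Fin 6)) (ε : Fin 6 → ℂ) :
      Solvable (fun i => ε i + ((∑ j ∈ s, Pi.single j (n j) : Fin 6 → ℤ) i : ℤ)) ↔ Solvable ε := by
    induction s using Finset.induction_on with
    | empty => simp
    | insert j s hj ih =>
      refine Iff.trans ?_ ih
      refine Iff.trans (Eq.to_iff (congrArg Solvable ?_)) (h2 j (n j) _)
      funext i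
      rw [Finset.sum_insert hj, Pi.add_apply, Int.cast_add]
      ring
  have := h3 Finset.univ ε
  rwa [Finset.univ_sum_single] at this

theorem Solvable.of_isInt {ε ε' : Fin 6 → ℂ} (h : Solvable ε) (π : Equiv.Perm (Fin 6)) (c : ℂ)
    (hε : ∀ i, IsInt (ε' i - ε (π i) - c)) : Solvable ε' := by
  choose n hn using hε
  have h1 := (solvable_add_int n _).2 (((solvable_comp_perm π ε).2 h).add_const c)
  convert h1 using 1
  funext i
  rw [← hn i, Function.comp_apply]; ring

/-! ### Seed solutions -/

theorem isDressingChain_seed {u v : RatFunc ℂ} (x : ℂ) (hadd : u + v = RatFunc.X)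
    (hsub : v ^ 2 - u ^ 2 = RatFunc.C (x - 1 / 2)) :
    IsDressingChain (paramOf ![1, x, 0, 0, 0, 0]) ![u, v, u, -u, u, -u] ∧
    IsDressingChain (paramOf ![1 - x, 1 - x, 1 - x, 0, 0, 0]) ![u, -u, u, v, -v, v] := by
  have h1 : RatFunc.C (1 / 2) * dRat (u + v) =
      RatFunc.C (1 - x) + v ^ 2 - u ^ 2 := by
    rw [hadd, dRat_X, add_sub_assoc, hsub, ← map_add, mul_one]; congr 1; ring
  have h2 : RatFunc.C (1 / 2) * dRat (v + u) =
      RatFunc.C x + u ^ 2 - v ^ 2 := by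
    rw [add_comm, hadd, dRat_X, add_sub_assoc, ← neg_sub (v ^ 2), hsub, ← map_neg, ← map_add,
      mul_one]
    congr 1; ring
  refine ⟨⟨fun i => ?_, ?_⟩, ⟨fun i => ?_, ?_⟩⟩
  · fin_cases i
    · simpa [paramOf, -one_div, -map_add] using h1
    · simpa [paramOf, -one_div, -map_add] using h2
    all_goals simp [paramOf]
  · simp [← hadd]
  · fin_cases i
    on_goal 3 => simpa [paramOf, -one_div, -map_add] using h1
    on_goal 5 => simpa [paramOf, -one_div, -map_add] using h2
    all_goals simp [paramOf]
  · simp [← hadd]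

theorem solvable_seed (x : ℂ) :
    Solvable ![1, x, 0, 0, 0, 0] ∧ Solvable ![1 - x, 1 - x, 1 - x, 0, 0, 0] := by
  set d : ℂ := (1 / 2 - x) / 2 with hd
  set w : RatFunc ℂ := RatFunc.C (1 / 2) * RatFunc.X with hw
  set z : RatFunc ℂ := RatFunc.C d * RatFunc.X⁻¹ with hz
  have hww : w + w = RatFunc.X := by
    rw [hw, ← add_mul, ← map_add, add_halves, map_one, one_mul]
  have hwz : w * z = RatFunc.C (d / 2) := by
    rw [hw, hz, mul_mul_mul_comm, mul_inv_cancel₀ RatFunc.X_ne_zero, mul_one, ← map_mul]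
    congr 1; ring
  have hw' : LeadInf 1 (1 / 2) w := by
    simpa only [mul_one] using LeadInf.ratX.C_mul (1 / 2)
  have hz' : LeadInf 1 0 z := ((LeadInf.ratX.inv one_ne_zero).C_mul d).raise (by norm_num)
  have hu : LeadInf 1 (1 / 2) (w + z) := by simpa using hw'.add hz'
  have hv : LeadInf 1 (1 / 2) (w - z) := by simpa using hw'.sub hz'
  have hu' : LeadInf 1 (-1 / 2) (-(w + z)) := by simpa [neg_div] using hu.neg
  have hv' : LeadInf 1 (-1 / 2) (-(w - z)) := by simpa [neg_div] using hv.neg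
  obtain ⟨h1, h2⟩ := isDressingChain_seed (u := w + z) (v := w - z) x (by rw [← hww]; ring) (by
    have h4 : (w - z) ^ 2 - (w + z) ^ 2 = RatFunc.C (-4) * (w * z) := by
      simp only [map_neg, map_ofNat]; ring
    rw [h4, hwz, ← map_mul, hd]; congr 1; ring)
  refine ⟨⟨![true, true, true, false, true, false], _, h1, HasSigns.of_leadInf (by decide) ?_⟩,
    ⟨![true, false, true, true, false, true], _, h2, HasSigns.of_leadInf (by decide) ?_⟩⟩
  · intro i; fin_cases i
    exacts [hu, hv, hu, hu', hu, hu']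
  · intro i; fin_cases i
    exacts [hu, hu', hu, hv, hv', hv]

theorem IsInt.sub_trans {a b c : ℂ} (h : IsInt (a - b)) (h' : IsInt (b - c)) : IsInt (a - c) := by
  simpa using h.add h'

theorem IsInt.sub_symm {a b : ℂ} (h : IsInt (a - b)) : IsInt (b - a) := by
  simpa using h.neg

theorem isInt_zero : IsInt 0 := by simpa using isInt_intCast 0

theorem Solvable.of_isInt_sub {s ε : Fin 6 → ℂ} (h : Solvable s) (e : Equiv.Perm (Fin 6)) (c : ℂ)
    (hε : ∀ k, IsInt (ε (e k) - s k - c)) : Solvable ε :=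
  h.of_isInt e.symm c fun i => by simpa using hε (e.symm i)

theorem solvable_of_five {ε : Fin 6 → ℂ} (e : Equiv.Perm (Fin 6))
    (h23 : IsInt (ε (e 2) - ε (e 3))) (h34 : IsInt (ε (e 3) - ε (e 4)))
    (h45 : IsInt (ε (e 4) - ε (e 5))) (h50 : IsInt (ε (e 5) - ε (e 0))) : Solvable ε := by
  refine (solvable_seed (ε (e 1) - ε (e 0))).1.of_isInt_sub e (ε (e 0)) fun k => ?_
  fin_cases k
  · simpa using (isInt_intCast 1).neg
  · simpa using isInt_zero
  · simpa using h23.sub_trans (h34.sub_trans (h45.sub_trans h50))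
  · simpa using h34.sub_trans (h45.sub_trans h50)
  · simpa using h45.sub_trans h50
  · simpa using h50

theorem solvable_of_triples {ε : Fin 6 → ℂ} (e : Equiv.Perm (Fin 6))
    (h01 : IsInt (ε (e 0) - ε (e 1))) (h12 : IsInt (ε (e 1) - ε (e 2)))
    (h34 : IsInt (ε (e 3) - ε (e 4))) (h45 : IsInt (ε (e 4) - ε (e 5))) : Solvable ε := by
  refine (solvable_seed (1 - (ε (e 0) - ε (e 3)))).2.of_isInt_sub e (ε (e 3)) fun k => ?_
  fin_cases k
  · simpa using isInt_zero
  · simpa [sub_sub] using h01.sub_symm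
  · simpa [sub_sub] using (h01.sub_trans h12).sub_symm
  · simpa using isInt_zero
  · simpa using h34.sub_symm
  · simpa using (h34.sub_trans h45).sub_symm

theorem ParamCond.solvable {ε : Fin 6 → ℂ} (h : ParamCond (paramOf ε)) : Solvable ε := by
  have hp (i : Fin 6) : IsInt (ε i - ε (i + 1) - paramOf ε i) := by
    rw [paramOf]
    split_ifs
    · simpa using (isInt_intCast 1).neg
    · simpa using isInt_zero
  have hint {i j : Fin 6} (hij : i + 1 = j) (h : IsInt (paramOf ε i)) : IsInt (ε i - ε j) := by
    subst hij
    simpa using (hp i).add h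
  have hadd {i j k : Fin 6} (hij : i + 1 = j) (hjk : j + 1 = k)
      (h : IsInt (paramOf ε i + paramOf ε j)) : IsInt (ε i - ε k) := by
    subst hij hjk
    convert ((hp i).add (hp (i + 1))).add h using 1; ring
  have hi (i : Fin 6) : i + 5 + 1 = i := by rw [add_assoc]; exact add_zero i
  have ha (i a : Fin 6) : i + a + 1 = i + (a + 1) := add_assoc i a 1
  rcases h with ⟨i, a, b, c, d⟩ | ⟨i, a, b, c, d⟩ | ⟨i, a, b, c, d⟩ | ⟨i, a, b, c, d⟩ |
    ⟨i, a, b, c, d, -⟩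
  · refine solvable_of_five (Equiv.addLeft i) ?_ ?_ ?_ ?_
    · exact hint (ha i 2) a
    · exact hint (ha i 3) b
    · exact hint (ha i 4) c
    · exact hint (ha i 5) d
  · refine solvable_of_triples (Equiv.addLeft (i + 1)) ?_ ?_ ?_ ?_
    all_goals simp only [Equiv.coe_addLeft, add_assoc, Fin.reduceAdd]
    · exact hint (ha i 1) a
    · exact hint (ha i 2) b
    · exact hint (ha i 4) c
    · exact hint (ha i 5) d
  · have h34 : IsInt (ε (i + 3) - ε (i + 4)) := hint (ha i 3) a
    have h50 : IsInt (ε (i + 5) - ε i) := hint (hi i) b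
    have h41 : IsInt (ε (i + 4) - ε (i + 1)) := by
      convert (((hp i).add (hp (i + 4))).add c).add h50 using 1
      rw [ha]; simp only [Fin.reduceAdd]; ring
    have h02 : IsInt (ε i - ε (i + 2)) := by
      convert (((hp i).sub (hp (i + 2))).add d).sub (h34.sub_trans h41) using 1
      rw [ha]; simp only [Fin.reduceAdd]; ring
    let π : Equiv.Perm (Fin 6) := ⟨![3, 4, 1, 5, 0, 2], ![4, 2, 5, 0, 1, 3], by decide, by decide⟩
    refine solvable_of_triples (π.trans (Equiv.addLeft i)) h34 h41 ?_ ?_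
    · simpa [π] using h50
    · simpa [π] using h02
  all_goals
    let π : Equiv.Perm (Fin 6) := ⟨![0, 2, 4, 1, 5, 3], ![0, 3, 1, 5, 2, 4], by decide, by decide⟩
  · have h35 : IsInt (ε (i + 3) - ε (i + 5)) := hadd (ha i 3) (ha i 4) a
    have h40 : IsInt (ε (i + 4) - ε i) := hadd (ha i 4) (hi i) b
    have h02 : IsInt (ε i - ε (i + 2)) := hadd rfl (ha i 1) c
    have h15 : IsInt (ε (i + 1) - ε (i + 5)) := by
      convert (((hp (i + 4)).sub (hp i)).sub d).sub h40 using 1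
      rw [ha]; simp only [Fin.reduceAdd]; ring
    refine solvable_of_triples (π.trans (Equiv.addLeft i)) ?_ ?_ h15 h35.sub_symm
    · simpa [π] using h02
    · simpa [π] using (h40.sub_trans h02).sub_symm
  · have h02 : IsInt (ε i - ε (i + 2)) := hadd rfl (ha i 1) a
    have h51 : IsInt (ε (i + 5) - ε (i + 1)) := hadd (hi i) rfl (by rwa [add_comm])
    have h24 : IsInt (ε (i + 2) - ε (i + 4)) := hadd (ha i 2) (ha i 3) c
    have h35 : IsInt (ε (i + 3) - ε (i + 5)) := hadd (ha i 3) (ha i 4) d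
    refine solvable_of_triples (π.trans (Equiv.addLeft i)) ?_ h24 h51.sub_symm h35.sub_symm
    simpa [π] using h02

theorem exists_paramOf_eq {α : Fin 6 → ℂ} (hsum : α 0 + α 1 + α 2 + α 3 + α 4 + α 5 = 1) :
    ∃ ε, paramOf ε = α := by
  refine ⟨![0, -α 0, -(α 0 + α 1), -(α 0 + α 1 + α 2), -(α 0 + α 1 + α 2 + α 3),
    -(α 0 + α 1 + α 2 + α 3 + α 4)], ?_⟩
  funext i
  fin_cases i <;> simp [paramOf]
  linear_combination -hsum

/-- Necessary and sufficient conditions for `A₅(α)` to have a rational solution of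
Type A. -/
theorem stmt_17 (α : Fin 6 → ℂ)
    (hsum : α 0 + α 1 + α 2 + α 3 + α 4 + α 5 = 1) :
    (∃ f : Fin 6 → RatFunc ℂ, IsA5Solution α f ∧ TypeA f) ↔
      ((∃ i : Fin 6, IsInt (α (i + 2)) ∧ IsInt (α (i + 3)) ∧ IsInt (α (i + 4)) ∧
          IsInt (α (i + 5))) ∨
       (∃ i : Fin 6, IsInt (α (i + 1)) ∧ IsInt (α (i + 2)) ∧ IsInt (α (i + 4)) ∧
          IsInt (α (i + 5))) ∨
       (∃ i : Fin 6, IsInt (α (i + 3)) ∧ IsInt (α (i + 5)) ∧ IsInt (α i + α (i + 4)) ∧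
          IsInt (α i - α (i + 2))) ∨
       (∃ i : Fin 6, IsInt (α (i + 3) + α (i + 4)) ∧ IsInt (α (i + 4) + α (i + 5)) ∧
          IsInt (α i + α (i + 1)) ∧ IsInt (α i - α (i + 4))) ∨
       (∃ i : Fin 6, IsInt (α i + α (i + 1)) ∧ IsInt (α i + α (i + 5)) ∧
          IsInt (α (i + 2) + α (i + 3)) ∧ IsInt (α (i + 3) + α (i + 4)) ∧
          IsInt (α i + α (i + 3)))) := by

  constructor
  · rintro ⟨f, hf, hA⟩
    obtain ⟨q, hq, hfq⟩ := hf.exists_isDressingChain hsum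
    obtain rfl : f = fun i => q i + q (i + 1) := funext hfq
    obtain ⟨σ, hσ⟩ := TypeA.exists_hasSigns hq hA
    exact hq.paramCond hσ
  · intro h
    obtain ⟨ε, rfl⟩ := exists_paramOf_eq hsum
    obtain ⟨σ, q, hq, hσ⟩ := ParamCond.solvable h
    exact ⟨_, hq.isA5Solution, hσ.typeA⟩
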